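/- Let (c,u) be a travelling-wave solution of the one-species free-boundary problem such that u is globally Lipschitz, ∂ₓu < 0 on Ω = {u > 0}, and the free boundary is Γ = {(φ(y), y) : y < 0} with φ real-analytic and locally Lipschitz and with (0,0) in the closure of Γ. Assume c > c₀, and let α ∈ (0, π/2) be defined by sin α = c₀/c. Then lim_{y→-∞} φ'(y) = -cotan α; in other words, the free boundary Γ has an asymptotic direction at infinity, namely a line making the angle α with the horizontal. -/

import Mathlib

open Real Filter Topology Set Asymptotics

noncomputable section

/-- Partial derivative in the first (horizontal) variable. -/
def pdx (u : ℝ → ℝ → ℝ) (x y : ℝ) : ℝ := deriv (fun t => u t y) x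

/-- Partial derivative in the second (vertical) variable. -/
def pdy (u : ℝ → ℝ → ℝ) (x y : ℝ) : ℝ := deriv (fun t => u x t) y

/-- Second partial derivative in the first variable. -/
def pdxx (u : ℝ → ℝ → ℝ) (x y : ℝ) : ℝ := deriv (fun t => pdx u t y) x

/-- Second partial derivative in the second variable. -/
def pdyy (u : ℝ → ℝ → ℝ) (x y : ℝ) : ℝ := deriv (fun t => pdy u x t) y

/-- The closed lower half-plane `H = {(x,y) : y ≤ 0}`. -/
def lowerH : Set (ℝ × ℝ) := {p | p.2 ≤ 0}

/-- The positivity set `Ω = {u > 0}` inside the closed lower half-plane. -/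
def posSet (u : ℝ → ℝ → ℝ) : Set (ℝ × ℝ) := {p | p.2 ≤ 0 ∧ 0 < u p.1 p.2}

/-- The free boundary `Γ = ∂Ω ∩ {y < 0}`. -/
def freeBdry (u : ℝ → ℝ → ℝ) : Set (ℝ × ℝ) :=
  frontier (posSet u) ∩ {p | p.2 < 0}

/-- A travelling-wave solution of the one-species free-boundary problem in the
lower half-plane, with diffusivities `d` (field), `D` (road), exchange parameter `μ`
and speed `c`. -/
structure OneSpeciesTW (d D μ c : ℝ) (u : ℝ → ℝ → ℝ) : Prop where
  c_pos : 0 < c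
  cont : ContinuousOn (fun p : ℝ × ℝ => u p.1 p.2) lowerH
  mem01 : ∀ x y : ℝ, y ≤ 0 → u x y ∈ Icc (0:ℝ) 1
  relOpen : ∃ V : Set (ℝ × ℝ), IsOpen V ∧ posSet u = V ∩ lowerH
  smooth : ContDiffOn ℝ 2 (fun p : ℝ × ℝ => u p.1 p.2) (posSet u ∩ {p | p.2 < 0})
  pde : ∀ p ∈ posSet u ∩ {p : ℝ × ℝ | p.2 < 0},
      -d * (pdxx u p.1 p.2 + pdyy u p.1 p.2) + c * pdx u p.1 p.2 = 0
  grad_ext : ∃ G₁ G₂ : ℝ × ℝ → ℝ,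
      ContinuousOn G₁ (posSet u ∪ freeBdry u) ∧
      ContinuousOn G₂ (posSet u ∪ freeBdry u) ∧
      (∀ p ∈ posSet u ∩ {p : ℝ × ℝ | p.2 < 0},
        G₁ p = pdx u p.1 p.2 ∧ G₂ p = pdy u p.1 p.2) ∧
      (∀ p ∈ freeBdry u, (G₁ p) ^ 2 + (G₂ p) ^ 2 = 1)
  road_diffx : ∀ x : ℝ, 0 < u x 0 → DifferentiableAt ℝ (fun t => u t 0) x
  road_diffxx : ∀ x : ℝ, 0 < u x 0 → DifferentiableAt ℝ (fun t => pdx u t 0) x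
  road_diffy : ∀ x : ℝ, 0 < u x 0 → DifferentiableAt ℝ (fun t => u x t) 0
  road : ∀ x : ℝ, 0 < u x 0 →
      -D * pdxx u x 0 + c * pdx u x 0 + (1/μ) * pdy u x 0 = 0
  lim_left : ∀ ε > 0, ∃ M : ℝ, ∀ x ≤ M, ∀ y ≤ (0:ℝ), |u x y - 1| < ε
  lim_right : ∀ y ≤ (0:ℝ), Tendsto (fun x => u x y) atTop (𝓝 0)

lemma mvt_ge {f f' : ℝ → ℝ} {c a b : ℝ} (hab : a ≤ b)
    (hf : ∀ t ∈ Icc a b, HasDerivAt f (f' t) t) (hc : ∀ t ∈ Icc a b, c ≤ f' t) :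
    c * (b - a) ≤ f b - f a := by
  refine (convex_Icc a b).mul_sub_le_image_sub_of_le_deriv
    (fun t ht => (hf t ht).continuousAt.continuousWithinAt)
    (fun t ht => (hf t (interior_subset ht)).differentiableAt.differentiableWithinAt)
    (fun t ht => ?_) a (left_mem_Icc.2 hab) b (right_mem_Icc.2 hab) hab
  rw [(hf t (interior_subset ht)).deriv]
  exact hc t (interior_subset ht)

lemma barrier_ge {f f' : ℝ → ℝ} {m a b : ℝ} (hab : a ≤ b)
    (hf : ∀ t ∈ Icc a b, HasDerivAt f (f' t) t) (ha : m ≤ f a)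
    (hc : ∀ t ∈ Icc a b, f t = m → 0 < f' t) : m ≤ f b := by
  have := image_le_of_deriv_right_lt_deriv_boundary (f := fun t => - f t) (f' := fun t => - f' t)
    (a := a) (b := b) (B := fun _ => -m) (B' := fun _ => 0)
    (fun t ht => (hf t ht).continuousAt.neg.continuousWithinAt)
    (fun t ht => (hf t (Ico_subset_Icc_self ht)).neg.hasDerivWithinAt)
    (by simpa using ha) (fun x => hasDerivAt_const _ _)
    (fun t ht h => by
      have := hc t (Ico_subset_Icc_self ht) (by simpa using h)
      simpa using this) (right_mem_Icc.2 hab)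
  simpa using this

lemma barrier_le {f f' : ℝ → ℝ} {m a b : ℝ} (hab : a ≤ b)
    (hf : ∀ t ∈ Icc a b, HasDerivAt f (f' t) t) (ha : f a ≤ m)
    (hc : ∀ t ∈ Icc a b, f t = m → f' t < 0) : f b ≤ m := by
  have := barrier_ge (f := fun t => - f t) (f' := fun t => - f' t) (m := -m) hab
    (fun t ht => (hf t ht).neg) (by simpa using ha)
    (fun t ht h => by simpa using hc t ht (by simpa using h))
  simpa using this

lemma exists_cos_ne {γ a b : ℝ} (hγ : 1 < γ) (hab : a < b) :
    ∃ m ∈ Ioo a b, γ * Real.cos m ≠ 1 := by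
  by_contra! h
  set c := (a + b) / 2 with hc
  have hcm : c ∈ Ioo a b := ⟨by rw [hc]; linarith, by rw [hc]; linarith⟩
  have h1 : (fun m => γ * Real.cos m) =ᶠ[𝓝 c] fun _ => (1:ℝ) := by
    filter_upwards [Ioo_mem_nhds hcm.1 hcm.2] with m hm using h m hm
  have h2 : deriv (fun m => γ * Real.cos m) c = 0 := by rw [h1.deriv_eq]; simp
  have h3 : HasDerivAt (fun m => γ * Real.cos m) (γ * (-Real.sin c)) c :=
    (Real.hasDerivAt_cos c).const_mul γ
  rw [h3.deriv] at h2
  have h4 : Real.sin c = 0 := by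
    rcases mul_eq_zero.1 h2 with h | h <;> linarith
  have h5 := h c hcm
  have h6 := Real.sin_sq_add_cos_sq c
  rw [h4] at h6
  have h7 : γ ^ 2 * Real.cos c ^ 2 = 1 := by
    rw [← mul_pow, h5]; norm_num
  nlinarith

/-- bound away from vertical slope -/
lemma ode_step1 {γ A T0 : ℝ} {Θ Θ' : ℝ → ℝ} (hγ : 1 < γ) (hT0 : 0 < T0) (hA : 0 ≤ A)
    (hr : ∀ T > T0, |Θ T| < π / 2)
    (hΘ : ∀ T > T0, HasDerivAt Θ (Θ' T) T)
    (hode : ∀ T > T0, 1 - γ * Real.cos (Θ T) - A / T ^ 2 ≤ Real.cos (Θ T) * Θ' T) :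
    ∃ T1 > T0, ∀ T ≥ T1, 1 / (2 * γ) ≤ Real.cos (Θ T) := by
  obtain ⟨Ta, hTa, hTa'⟩ : ∃ Ta > T0, ∀ T ≥ Ta, A / T ^ 2 ≤ 1 / 4 := by
    refine ⟨T0 + 1 + 4 * A, by linarith, fun T hT => ?_⟩
    have : 1 ≤ T ∨ T < 1 := le_or_gt _ _
    have hT1 : 1 ≤ T := by linarith
    rw [div_le_iff₀ (by positivity)]
    nlinarith
  have hs' : ∀ T > T0, HasDerivAt (fun t => Real.sin (Θ t)) (Real.cos (Θ T) * Θ' T) T :=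
    fun T hT => (hΘ T hT).sin
  have hg : ∀ T ≥ Ta, Real.cos (Θ T) ≤ 1 / (2 * γ) → 1 / 4 ≤ Real.cos (Θ T) * Θ' T := by
    intro T hT hc
    have h1 := hode T (by linarith)
    have h2 := hTa' T hT
    have h3 : γ * Real.cos (Θ T) ≤ 1 / 2 := by
      calc γ * Real.cos (Θ T) ≤ γ * (1 / (2 * γ)) := by gcongr
        _ = 1 / 2 := by field_simp
    linarith
  -- never bad forever
  have hforever : ∀ Tb ≥ Ta, ∃ T ≥ Tb, 1 / (2 * γ) < Real.cos (Θ T) := by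
    intro Tb hTb
    by_contra! h
    have := mvt_ge (f := fun t => Real.sin (Θ t)) (c := 1 / 4) (a := Tb) (b := Tb + 12)
      (by linarith) (fun t ht => hs' t (by linarith [ht.1]))
      (fun t ht => hg t (by linarith [ht.1]) (h t ht.1))
    have h1 := Real.sin_le_one (Θ (Tb + 12))
    have h2 := Real.neg_one_le_sin (Θ Tb)
    linarith
  obtain ⟨T1, hT1, hT1'⟩ := hforever Ta le_rfl
  refine ⟨T1, by linarith, fun T hT => ?_⟩
  by_contra! hlt
  have hcp : ∀ T > T0, 0 < Real.cos (Θ T) := fun T hT =>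
    Real.cos_pos_of_mem_Ioo ⟨by linarith [abs_lt.1 (hr T hT)], (abs_lt.1 (hr T hT)).2⟩
  have hcsin : ∀ x : ℝ, 0 < Real.cos x → (Real.cos x ≤ 1 / (2 * γ) ↔
      1 - (1 / (2 * γ)) ^ 2 ≤ Real.sin x ^ 2) := by
    intro x hx
    have := Real.sin_sq_add_cos_sq x
    have hk : 0 < 1 / (2 * γ) := by positivity
    constructor
    · intro h; nlinarith
    · intro h; by_contra! h'; nlinarith
  have hk : 0 < 1 / (2 * γ) := by positivity
  have hk1 : 1 / (2 * γ) < 1 := by rw [div_lt_one (by positivity)]; linarith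
  set s1 := √(1 - (1 / (2 * γ)) ^ 2) with hs1
  have hs1sq : s1 ^ 2 = 1 - (1 / (2 * γ)) ^ 2 := Real.sq_sqrt (by nlinarith)
  have hs1p : 0 < s1 := Real.sqrt_pos.2 (by nlinarith)
  rcases le_or_gt 0 (Real.sin (Θ T)) with hs | hs
  · -- stays ≥ s1 forever
    have hTs : s1 ≤ Real.sin (Θ T) := by
      have := (hcsin _ (hcp T (by linarith))).1 hlt.le
      rw [← hs1sq] at this
      exact (pow_le_pow_iff_left₀ hs1p.le hs two_ne_zero).1 this
    obtain ⟨T2, hT2, hT2'⟩ := hforever T (by linarith)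
    have h1 : s1 ≤ Real.sin (Θ T2) := by
      refine barrier_ge (f := fun t => Real.sin (Θ t)) hT2
        (fun t ht => hs' t (by linarith [ht.1])) hTs (fun t ht h => ?_)
      have h2 := (hcsin _ (hcp t (by linarith [ht.1]))).2 (by rw [← hs1sq]; rw [h])
      linarith [hg t (by linarith [ht.1]) h2]
    have h2 := (hcsin _ (hcp T2 (by linarith))).2 (by rw [← hs1sq]; nlinarith)
    linarith
  · have h0 : -s1 ≤ Real.sin (Θ T1) := by
      by_contra! h
      have := (hcsin _ (hcp T1 (by linarith))).2 (by rw [← hs1sq]; nlinarith)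
      linarith
    have h1 : -s1 ≤ Real.sin (Θ T) := by
      refine barrier_ge (f := fun t => Real.sin (Θ t)) hT
        (fun t ht => hs' t (by linarith [ht.1])) h0 (fun t ht h => ?_)
      have h2 := (hcsin _ (hcp t (by linarith [ht.1]))).2
        (by rw [← hs1sq]; rw [h]; simp)
      linarith [hg t (by linarith [ht.1]) h2]
    have h3 : 1 - (1 / (2 * γ)) ^ 2 < Real.sin (Θ T) ^ 2 := by
      have := Real.sin_sq_add_cos_sq (Θ T)
      have := hcp T (by linarith)
      nlinarith
    rw [← hs1sq] at h3
    nlinarith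

lemma ode_part {γ A T0 M C1 C2 α : ℝ} {Θ Θ' Φ z Z : ℝ → ℝ} (hγ : 1 < γ) (hT0 : 0 < T0)
    (hA : 0 ≤ A)
    (hr : ∀ T > T0, |Θ T| < π / 2)
    (hΘ : ∀ T > T0, HasDerivAt Θ (Θ' T) T)
    (hode : ∀ T > T0, 1 - γ * Real.cos (Θ T) - A / T ^ 2 ≤ Real.cos (Θ T) * Θ' T)
    (hz : ∀ T > T0, HasDerivAt z ((Real.cos (Θ T))⁻¹ - γ) T)
    (hZ : ∀ T > T0, HasDerivAt Z (z T) T)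
    (hZb : ∀ T > T0, -C2 - C1 * T ≤ Z T)
    (hΦ : ∀ T > T0, HasDerivAt Φ (Real.tan (Θ T)) T)
    (hΦM : ∀ T > T0, M ≤ Φ T)
    (hα : α ∈ Ioo 0 (π / 2)) (hsin : Real.sin α = 1 / γ) :
    Tendsto Θ atTop (𝓝 (π / 2 - α)) := by
  obtain ⟨T1, hT1, hcos⟩ := ode_step1 hγ hT0 hA hr hΘ hode
  have hγ0 : 0 < γ := by linarith
  have hk : 0 < 1 / (2 * γ) := by positivity
  have hcp : ∀ T ≥ T1, 0 < Real.cos (Θ T) := fun T hT => hk.trans_le (hcos T hT)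
  have hTp : ∀ T ≥ T1, 0 < T := fun T hT => by linarith
  -- K monotone
  set K : ℝ → ℝ := fun T => Θ T - z T - (2 * γ * A) / T with hK
  have hKd : ∀ T ≥ T1, HasDerivAt K (Θ' T - ((Real.cos (Θ T))⁻¹ - γ) + 2 * γ * A / T ^ 2) T := by
    intro T hT
    have h1 := ((hΘ T (by linarith)).sub (hz T (by linarith))).sub
      ((hasDerivAt_inv (hTp T hT).ne').const_mul (2 * γ * A))
    refine (h1.congr_of_eventuallyEq (Eventually.of_forall fun t => ?_)).congr_deriv ?_
    · simp [hK, div_eq_mul_inv]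
    · ring
  have hKn : ∀ T ≥ T1, 0 ≤ Θ' T - ((Real.cos (Θ T))⁻¹ - γ) + 2 * γ * A / T ^ 2 := by
    intro T hT
    have h1 := hode T (by linarith)
    have h2 := hcp T hT
    have h3 : (Real.cos (Θ T))⁻¹ ≤ 2 * γ := by
      have := inv_anti₀ hk (hcos T hT)
      simpa using this
    have h4 : (Real.cos (Θ T))⁻¹ * (1 - γ * Real.cos (Θ T) - A / T ^ 2) ≤ Θ' T := by
      rw [inv_mul_le_iff₀ h2]; exact h1
    have h5 : (Real.cos (Θ T))⁻¹ * (1 - γ * Real.cos (Θ T) - A / T ^ 2) =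
      (Real.cos (Θ T))⁻¹ - γ - (Real.cos (Θ T))⁻¹ * (A / T ^ 2) := by
      field_simp
    have h6 : (Real.cos (Θ T))⁻¹ * (A / T ^ 2) ≤ 2 * γ * (A / T ^ 2) := by
      gcongr
    have h7 : 2 * γ * (A / T ^ 2) = 2 * γ * A / T ^ 2 := by ring
    linarith
  have hKm : Monotone (fun T => K (max T T1)) := by
    intro a b hab
    have hab' : max a T1 ≤ max b T1 := max_le_max_right _ hab
    have := mvt_ge (f := K) (c := 0) hab'
      (fun t ht => hKd t ((le_max_right _ _).trans ht.1))
      (fun t ht => hKn t ((le_max_right _ _).trans ht.1))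
    simp only; linarith
  have hKe : (fun T => K (max T T1)) =ᶠ[atTop] K := by
    filter_upwards [eventually_ge_atTop T1] with T hT
    rw [max_eq_left hT]
  have hinv : Tendsto (fun T : ℝ => (2 * γ * A) / T) atTop (𝓝 0) :=
    tendsto_const_nhds.div_atTop tendsto_id
  have hlim : ∃ k, Tendsto K atTop (𝓝 k) := by
    rcases tendsto_atTop_of_monotone hKm with h | ⟨l, h⟩
    · exfalso
      have hKt : Tendsto K atTop atTop := h.congr' hKe
      obtain ⟨T2, hT2⟩ := (((hKt.eventually_ge_atTop (π / 2 + C1 + 1)).and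
        (eventually_ge_atTop T1))).exists_forall_of_atTop
      have hzle : ∀ T ≥ T2, z T ≤ -C1 - 1 := by
        intro T hT
        have h1 := (hT2 T hT).1
        have h2 := (hT2 T hT).2
        have h3 := (abs_lt.1 (hr T (by linarith))).2
        have h4 : 0 ≤ 2 * γ * A / T := by
          have := hTp T h2
          positivity
        simp only [hK] at h1
        linarith
      have hT21 := (hT2 T2 le_rfl).2
      set T3 := T2 + (|Z T2| + |C2| + |C1 * T2| + 1) with hT3
      have hT23 : T2 ≤ T3 := by
        have := abs_nonneg (Z T2); have := abs_nonneg C2; have := abs_nonneg (C1 * T2)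
        linarith
      have h1 := mvt_ge (f := fun t => - Z t) (f' := fun t => - z t) (c := C1 + 1) hT23
        (fun t ht => (hZ t (by linarith [ht.1])).neg)
        (fun t ht => by linarith [hzle t ht.1])
      have h2 := hZb T3 (by linarith)
      have := le_abs_self (Z T2); have := le_abs_self C2; have := neg_abs_le (C1 * T2)
      have : (C1 + 1) * (T3 - T2) = C1 * T3 - C1 * T2 + (T3 - T2) := by ring
      have := le_abs_self (C1 * T2)
      linarith
    · exact ⟨l, h.congr' hKe⟩
  obtain ⟨k, hk'⟩ := hlim
  -- ζ
  set ζ : ℝ → ℝ := fun T => z T + k with hζ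
  have hdiff : Tendsto (fun T => Θ T - ζ T) atTop (𝓝 0) := by
    have h1 := (hk'.add hinv).sub_const k
    simp only [add_zero, sub_self] at h1
    refine h1.congr fun T => ?_
    simp only [hK, hζ]; ring
  have hζd : ∀ T > T0, HasDerivAt ζ ((Real.cos (Θ T))⁻¹ - γ) T := fun T hT => (hz T hT).add_const k
  have hsmall : ∀ ε > 0, ∃ T2 ≥ T1, ∀ T ≥ T2, |Θ T - ζ T| < ε := by
    intro ε hε
    have h1 := (Metric.tendsto_nhds.1 hdiff ε hε).and (eventually_ge_atTop T1)
    obtain ⟨T2, hT2⟩ := h1.exists_forall_of_atTop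
    exact ⟨T2, (hT2 T2 le_rfl).2, fun T hT => by simpa [Real.dist_eq] using (hT2 T hT).1⟩
  have hconv : ∃ l, Tendsto ζ atTop (𝓝 l) := by
    obtain ⟨Tb, hTb, hTb'⟩ := hsmall 1 one_pos
    refine tendsto_of_no_upcrossings dense_univ ?_ ?_ ?_
    · rintro a - b - hab ⟨h1, h2⟩
      obtain ⟨m, hm, hmne⟩ := exists_cos_ne hγ hab
      have hcc : ContinuousAt (fun x => γ * Real.cos x) m := by fun_prop
      rcases lt_or_gt_of_ne hmne with hlt | hgt
      · obtain ⟨δ, hδ, hδ'⟩ := Metric.eventually_nhds_iff.1 (hcc.eventually (gt_mem_nhds hlt))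
        obtain ⟨T2, hT2, hT2'⟩ := hsmall δ hδ
        obtain ⟨Ta, hTa, hTa'⟩ := (h2.and_eventually (eventually_ge_atTop T2)).exists
        obtain ⟨Tc, hTc, hTc'⟩ := (h1.and_eventually (eventually_ge_atTop Ta)).exists
        have := barrier_ge (f := ζ) (m := m) hTc' (fun t ht => hζd t (by linarith [ht.1]))
          (by linarith [hm.2]) (fun t ht h => ?_)
        · linarith [hm.1]
        · have h3 := hT2' t (by linarith [ht.1])
          rw [h] at h3
          have h4 := hδ' (y := Θ t) (by simpa [Real.dist_eq] using h3)
          have h5 := hcp t (by linarith [ht.1])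
          have h6 : γ < (Real.cos (Θ t))⁻¹ := by
            rw [lt_inv_comm₀ hγ0 h5, ← one_div, lt_div_iff₀ hγ0]; linarith
          linarith
      · obtain ⟨δ, hδ, hδ'⟩ := Metric.eventually_nhds_iff.1 (hcc.eventually (lt_mem_nhds hgt))
        obtain ⟨T2, hT2, hT2'⟩ := hsmall δ hδ
        obtain ⟨Ta, hTa, hTa'⟩ := (h1.and_eventually (eventually_ge_atTop T2)).exists
        obtain ⟨Tc, hTc, hTc'⟩ := (h2.and_eventually (eventually_ge_atTop Ta)).exists
        have := barrier_le (f := ζ) (m := m) hTc' (fun t ht => hζd t (by linarith [ht.1]))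
          (by linarith [hm.1]) (fun t ht h => ?_)
        · linarith [hm.2]
        · have h3 := hT2' t (by linarith [ht.1])
          rw [h] at h3
          have h4 := hδ' (y := Θ t) (by simpa [Real.dist_eq] using h3)
          have h5 := hcp t (by linarith [ht.1])
          have h6 : (Real.cos (Θ t))⁻¹ < γ := by
            rw [inv_lt_comm₀ h5 hγ0, ← one_div, div_lt_iff₀ hγ0]; linarith
          linarith
    · refine ⟨π / 2 + 1, ?_⟩
      simp only [eventually_map]
      filter_upwards [eventually_ge_atTop Tb] with T hT
      have h1 := (abs_lt.1 (hr T (by linarith))).2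
      have h2 := (abs_lt.1 (hTb' T hT)).1
      linarith
    · refine ⟨-(π / 2 + 1), ?_⟩
      simp only [eventually_map]
      filter_upwards [eventually_ge_atTop Tb] with T hT
      have h1 := (abs_lt.1 (hr T (by linarith))).1
      have h2 := (abs_lt.1 (hTb' T hT)).2
      show _ ≤ _
      linarith
  obtain ⟨l, hl⟩ := hconv
  have hΘl : Tendsto Θ atTop (𝓝 l) := by
    have := hdiff.add hl
    simpa using this
  have hcosl : Tendsto (fun T => Real.cos (Θ T)) atTop (𝓝 (Real.cos l)) :=
    (Real.continuous_cos.tendsto l).comp hΘl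
  have hcl : 1 / (2 * γ) ≤ Real.cos l :=
    ge_of_tendsto hcosl ((eventually_ge_atTop T1).mono fun T hT => hcos T hT)
  have hcl0 : 0 < Real.cos l := hk.trans_le hcl
  -- derivative limit zero
  have hgrow : ∀ (f f' : ℝ → ℝ) (e : ℝ), 0 < e → (∀ T > T0, HasDerivAt f (f' T) T) →
      Tendsto f' atTop (𝓝 e) → Tendsto f atTop atTop := by
    intro f f' e he hf hf'
    obtain ⟨T2, hT2⟩ := ((hf'.eventually (lt_mem_nhds (half_lt_self he))).and
      (eventually_gt_atTop T0)).exists_forall_of_atTop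
    have h1 : Tendsto (fun T => f T2 + e / 2 * (T - T2)) atTop atTop := by
      refine tendsto_atTop_add_const_left _ _ ?_
      exact (tendsto_atTop_add_const_right _ (-T2) tendsto_id).const_mul_atTop (by positivity)
    refine tendsto_atTop_mono' _ ?_ h1
    filter_upwards [eventually_ge_atTop T2] with T hT
    have := mvt_ge (f := f) (c := e / 2) hT (fun t ht => hf t (hT2 t ht.1).2)
      (fun t ht => (hT2 t ht.1).1.le)
    linarith
  have hql : Tendsto (fun T => (Real.cos (Θ T))⁻¹ - γ) atTop (𝓝 ((Real.cos l)⁻¹ - γ)) :=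
    (hcosl.inv₀ hcl0.ne').sub_const γ
  have hq0 : (Real.cos l)⁻¹ - γ = 0 := by
    rcases lt_trichotomy ((Real.cos l)⁻¹ - γ) 0 with h | h | h
    · exact absurd (hgrow (fun T => - ζ T) _ _ (neg_pos.2 h) (fun T hT => (hζd T hT).neg) hql.neg)
        (not_tendsto_atTop_of_tendsto_nhds hl.neg)
    · exact h
    · exact absurd (hgrow ζ _ _ h hζd hql) (not_tendsto_atTop_of_tendsto_nhds hl)
  have hlc : Real.cos l = Real.cos (π / 2 - α) := by
    rw [Real.cos_pi_div_two_sub, hsin, one_div, ← sub_eq_zero.1 hq0, inv_inv]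
  have hl1 : |l| ≤ π / 2 := by
    refine le_of_tendsto hΘl.abs ?_
    filter_upwards [eventually_gt_atTop T0] with T hT using (hr T hT).le
  have habs : |l| = π / 2 - α := by
    refine Real.injOn_cos ⟨abs_nonneg _, by linarith [Real.pi_pos]⟩
      ⟨by linarith [hα.2], by linarith [hα.1, Real.pi_pos]⟩ ?_
    rw [Real.cos_abs, hlc]
  rcases le_or_gt 0 l with h | h
  · rw [abs_of_nonneg h] at habs; rwa [habs] at hΘl
  · exfalso
    rw [abs_of_neg h] at habs
    have htan : Tendsto (fun T => Real.tan (Θ T)) atTop (𝓝 (Real.tan l)) :=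
      ((Real.continuousAt_tan.2 hcl0.ne').tendsto).comp hΘl
    have htl : Real.tan l < 0 := Real.tan_neg_of_neg_of_pi_div_two_lt h (by linarith [hα.1])
    have := hgrow (fun T => - Φ T) _ _ (neg_pos.2 htl) (fun T hT => (hΦ T hT).neg) htan.neg
    obtain ⟨T, hT, hT'⟩ := ((this.eventually_gt_atTop (-M)).and (eventually_gt_atTop T0)).exists
    linarith [hΦM T hT']


/-- second order expansion data along a line -/
def H2 (f : ℝ → ℝ) (t f1 f2 : ℝ) : Prop :=
  ∃ g : ℝ → ℝ, (∀ᶠ s in 𝓝 t, HasDerivAt f (g s) s) ∧ g t = f1 ∧ HasDerivAt g f2 t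

lemma H2.hasDerivAt {f : ℝ → ℝ} {t f1 f2 : ℝ} (h : H2 f t f1 f2) : HasDerivAt f f1 t := by
  obtain ⟨g, h1, h2, h3⟩ := h
  exact h2 ▸ h1.self_of_nhds

lemma H2.add {f k : ℝ → ℝ} {t f1 f2 k1 k2 : ℝ} (h : H2 f t f1 f2) (h' : H2 k t k1 k2) :
    H2 (fun s => f s + k s) t (f1 + k1) (f2 + k2) := by
  obtain ⟨g, h1, h2, h3⟩ := h
  obtain ⟨g', h1', h2', h3'⟩ := h'
  refine ⟨fun s => g s + g' s, ?_, by simp [h2, h2'], h3.add h3'⟩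
  filter_upwards [h1, h1'] with s a b using a.add b

lemma H2.const_mul {f : ℝ → ℝ} {t f1 f2 : ℝ} (c : ℝ) (h : H2 f t f1 f2) :
    H2 (fun s => c * f s) t (c * f1) (c * f2) := by
  obtain ⟨g, h1, h2, h3⟩ := h
  refine ⟨fun s => c * g s, ?_, by simp [h2], h3.const_mul c⟩
  filter_upwards [h1] with s a using a.const_mul c

lemma H2.sub {f k : ℝ → ℝ} {t f1 f2 k1 k2 : ℝ} (h : H2 f t f1 f2) (h' : H2 k t k1 k2) :
    H2 (fun s => f s - k s) t (f1 - k1) (f2 - k2) := by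
  obtain ⟨g, h1, h2, h3⟩ := h
  obtain ⟨g', h1', h2', h3'⟩ := h'
  refine ⟨fun s => g s - g' s, ?_, by simp [h2, h2'], h3.sub h3'⟩
  filter_upwards [h1, h1'] with s a b using a.sub b

lemma H2.mul {f k : ℝ → ℝ} {t f1 f2 k1 k2 : ℝ} (h : H2 f t f1 f2) (h' : H2 k t k1 k2) :
    H2 (fun s => f s * k s) t (f1 * k t + f t * k1) (f2 * k t + 2 * (f1 * k1) + f t * k2) := by
  have hf := h.hasDerivAt
  have hk := h'.hasDerivAt
  obtain ⟨g, h1, h2, h3⟩ := h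
  obtain ⟨g', h1', h2', h3'⟩ := h'
  refine ⟨fun s => g s * k s + f s * g' s, ?_, by simp [h2, h2'], ?_⟩
  · filter_upwards [h1, h1'] with s a b using a.mul b
  · refine ((h3.mul hk).add (hf.mul h3')).congr_deriv ?_
    rw [h2, h2']; ring

lemma H2.sqrt {f : ℝ → ℝ} {t f1 f2 : ℝ} (h : H2 f t f1 f2) (hp : 0 < f t) :
    H2 (fun s => √(f s)) t (f1 / (2 * √(f t)))
      (f2 / (2 * √(f t)) - f1 ^ 2 / (4 * f t * √(f t))) := by
  have hf := h.hasDerivAt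
  obtain ⟨g, h1, h2, h3⟩ := h
  refine ⟨fun s => g s / (2 * √(f s)), ?_, by simp [h2], ?_⟩
  · filter_upwards [h1, hf.continuousAt.eventually (lt_mem_nhds hp)] with s a b
      using a.sqrt b.ne'
  · have hs : 0 < √(f t) := Real.sqrt_pos.2 hp
    have := h3.div ((hf.sqrt hp.ne').const_mul 2) (by positivity)
    refine this.congr_deriv ?_
    rw [h2]
    have e : f t = √(f t) ^ 2 := (Real.sq_sqrt hp.le).symm
    set s := √(f t)
    rw [e]
    field_simp
    ring

lemma H2.nonpos {f : ℝ → ℝ} {t f1 f2 : ℝ} (h : H2 f t f1 f2) (hm : IsLocalMax f t) : 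
    f1 = 0 ∧ f2 ≤ 0 := by
  have hf := h.hasDerivAt
  have h0 : f1 = 0 := hm.hasDerivAt_eq_zero hf
  refine ⟨h0, ?_⟩
  obtain ⟨g, h1, h2, h3⟩ := h
  by_contra! hpos
  have hd : deriv f =ᶠ[𝓝 t] g := h1.mono fun s hs => hs.deriv
  have hdd : deriv (deriv f) t = f2 := by rw [hd.deriv_eq, h3.deriv]
  have hmin := isLocalMin_of_deriv_deriv_pos (f := f) (x₀ := t) (by rw [hdd]; exact hpos)
    (by rw [hf.deriv, h0]) hf.continuousAt
  have hc : f =ᶠ[𝓝 t] fun _ => f t := by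
    filter_upwards [hm, hmin] with s a b using le_antisymm a b
  have : deriv (deriv f) t = 0 := by
    rw [hc.deriv.deriv_eq]; simp
  linarith

/-- `f_xx + f_yy - γ f_x = v` at `p` -/
def MEq (γ : ℝ) (f : ℝ × ℝ → ℝ) (p : ℝ × ℝ) (v : ℝ) : Prop :=
  ∃ fx fxx fy fyy : ℝ, H2 (fun t => f (t, p.2)) p.1 fx fxx ∧ H2 (fun t => f (p.1, t)) p.2 fy fyy ∧
    fxx + fyy - γ * fx = v

lemma MEq.add {γ : ℝ} {f k : ℝ × ℝ → ℝ} {p : ℝ × ℝ} {v v' : ℝ} (h : MEq γ f p v)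
    (h' : MEq γ k p v') : MEq γ (fun q => f q + k q) p (v + v') := by
  obtain ⟨a, b, c, d, h1, h2, h3⟩ := h
  obtain ⟨a', b', c', d', h1', h2', h3'⟩ := h'
  exact ⟨_, _, _, _, h1.add h1', h2.add h2', by rw [← h3, ← h3']; ring⟩

lemma MEq.sub {γ : ℝ} {f k : ℝ × ℝ → ℝ} {p : ℝ × ℝ} {v v' : ℝ} (h : MEq γ f p v)
    (h' : MEq γ k p v') : MEq γ (fun q => f q - k q) p (v - v') := by
  obtain ⟨a, b, c, d, h1, h2, h3⟩ := h
  obtain ⟨a', b', c', d', h1', h2', h3'⟩ := h'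
  exact ⟨_, _, _, _, h1.sub h1', h2.sub h2', by rw [← h3, ← h3']; ring⟩

lemma MEq.const_mul {γ : ℝ} {f : ℝ × ℝ → ℝ} {p : ℝ × ℝ} {v : ℝ} (c : ℝ) (h : MEq γ f p v) :
    MEq γ (fun q => c * f q) p (c * v) := by
  obtain ⟨a, b, c', d, h1, h2, h3⟩ := h
  exact ⟨_, _, _, _, h1.const_mul c, h2.const_mul c, by rw [← h3]; ring⟩

lemma H2.shift {f : ℝ → ℝ} {t f1 f2 q : ℝ} (h : H2 f (t + q) f1 f2) :
    H2 (fun s => f (s + q)) t f1 f2 := by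
  obtain ⟨g, h1, h2, h3⟩ := h
  refine ⟨fun s => g (s + q), ?_, h2, h3.comp_add_const t q⟩
  have : Tendsto (fun s => s + q) (𝓝 t) (𝓝 (t + q)) := by
    apply Continuous.tendsto; fun_prop
  filter_upwards [this.eventually h1] with s hs using hs.comp_add_const s q

lemma MEq.shift {γ : ℝ} {f : ℝ × ℝ → ℝ} {p q : ℝ × ℝ} {v : ℝ} (h : MEq γ f (p + q) v) :
    MEq γ (fun r => f (r + q)) p v := by
  obtain ⟨a, b, c', d, h1, h2, h3⟩ := h
  exact ⟨_, _, _, _, h1.shift, h2.shift, h3⟩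

lemma MEq.nonpos {γ : ℝ} {f : ℝ × ℝ → ℝ} {p : ℝ × ℝ} {v : ℝ} (h : MEq γ f p v)
    (hm : IsLocalMax f p) : v ≤ 0 := by
  obtain ⟨a, b, c', d, h1, h2, h3⟩ := h
  have t1 : Tendsto (fun t : ℝ => (t, p.2)) (𝓝 p.1) (𝓝 p) := by
    have : Continuous fun t : ℝ => (t, p.2) := by fun_prop
    exact this.tendsto p.1
  have t2 : Tendsto (fun t : ℝ => (p.1, t)) (𝓝 p.2) (𝓝 p) := by
    have : Continuous fun t : ℝ => (p.1, t) := by fun_prop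
    exact this.tendsto p.2
  have m1 := h1.nonpos (t1.eventually hm)
  have m2 := h2.nonpos (t2.eventually hm)
  rw [← h3, m1.1]
  linarith [m1.2, m2.2]

lemma H2_pow4 (x0 t : ℝ) : H2 (fun s => (s - x0) ^ 4) t (4 * (t - x0) ^ 3) (12 * (t - x0) ^ 2) := by
  refine ⟨fun s => 4 * (s - x0) ^ 3, Eventually.of_forall fun s => ?_, rfl, ?_⟩
  · have := ((hasDerivAt_id s).sub_const x0).pow 4
    exact this.congr_deriv (by simp)
  · have := (((hasDerivAt_id t).sub_const x0).pow 3).const_mul 4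
    exact this.congr_deriv (by simp; ring)

lemma H2_const (t c : ℝ) : H2 (fun _ => c) t 0 0 :=
  ⟨fun _ => 0, Eventually.of_forall fun _ => hasDerivAt_const _ _, rfl, hasDerivAt_const _ _⟩

lemma visc {γ : ℝ} {W We ψ L : ℝ × ℝ → ℝ} {O : Set (ℝ × ℝ)} {X e : ℝ × ℝ} (hO : IsOpen O)
    (hX : X ∈ O) (hWc : ContinuousOn W O) (hWe : ContinuousOn We O)
    (hWd : ∀ p ∈ O, HasDerivAt (fun t : ℝ => W (p + t • e)) (We p) 0)
    (hWM : ∀ p ∈ O, MEq γ W p 0) (hψc : ContinuousOn ψ O)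
    (hψ : ∀ p ∈ O, MEq γ ψ p (L p)) (hL : ContinuousAt L X)
    (hm : IsLocalMax (fun p => We p - ψ p) X) : 0 ≤ L X := by
  by_contra! hneg
  set N : ℝ × ℝ → ℝ := fun p => (p.1 - X.1) ^ 4 + (p.2 - X.2) ^ 4 with hN
  set LN : ℝ × ℝ → ℝ := fun p => 12 * (p.1 - X.1) ^ 2 + 12 * (p.2 - X.2) ^ 2
    - γ * (4 * (p.1 - X.1) ^ 3) with hLN
  have hNM : ∀ p, MEq γ N p (LN p) := by
    intro p
    refine ⟨_, _, _, _, (H2_pow4 X.1 p.1).add (H2_const _ ((p.2 - X.2) ^ 4)),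
      (H2_const _ ((p.1 - X.1) ^ 4)).add (H2_pow4 X.2 p.2), ?_⟩
    simp only [hLN]; ring
  have hev : ∀ᶠ p in 𝓝 X, L p + LN p < 0 := by
    have : ContinuousAt (fun p => L p + LN p) X := by
      refine hL.add ?_
      apply Continuous.continuousAt
      fun_prop
    refine this.eventually (gt_mem_nhds ?_)
    simp [hLN, hneg]
  obtain ⟨ρ, hρ, hball⟩ := Metric.eventually_nhds_iff_ball.1
    ((hev.and (hO.mem_nhds hX)).and hm)
  set r := ρ / 3 with hr
  have hrp : 0 < r := by positivity
  have hsub : Metric.closedBall X (2 * r) ⊆ Metric.ball X ρ := by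
    intro p hp
    rw [Metric.mem_closedBall] at hp
    rw [Metric.mem_ball]; linarith
  have hK2 : IsCompact (Metric.closedBall X (2 * r)) := isCompact_closedBall _ _
  have hsubO : Metric.closedBall X (2 * r) ⊆ O := fun p hp => (hball p (hsub hp)).1.2
  have huc := hK2.uniformContinuousOn_of_continuous (hWe.mono hsubO)
  rw [Metric.uniformContinuousOn_iff] at huc
  obtain ⟨δ, hδ, huc⟩ := huc (r ^ 4 / 2) (by positivity)
  -- choose h
  obtain ⟨h, hh, hh1, hh2⟩ : ∃ h > 0, h * ‖e‖ < δ ∧ h * ‖e‖ ≤ r := by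
    refine ⟨min δ r / (2 * (‖e‖ + 1)), by positivity, ?_, ?_⟩
    · have h1 : min δ r / (2 * (‖e‖ + 1)) * ‖e‖ = min δ r * (‖e‖ / (2 * (‖e‖ + 1))) := by ring
      have h2 : ‖e‖ / (2 * (‖e‖ + 1)) < 1 := by
        rw [div_lt_one (by positivity)]; linarith [norm_nonneg e]
      rw [h1]
      calc min δ r * (‖e‖ / (2 * (‖e‖ + 1))) < min δ r * 1 := by gcongr
        _ ≤ δ := by rw [mul_one]; exact min_le_left _ _
    · have h1 : min δ r / (2 * (‖e‖ + 1)) * ‖e‖ = min δ r * (‖e‖ / (2 * (‖e‖ + 1))) := by ring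
      have h2 : ‖e‖ / (2 * (‖e‖ + 1)) < 1 := by
        rw [div_lt_one (by positivity)]; linarith [norm_nonneg e]
      rw [h1]
      calc min δ r * (‖e‖ / (2 * (‖e‖ + 1))) ≤ min δ r * 1 := by gcongr
        _ ≤ r := by rw [mul_one]; exact min_le_right _ _
  have hin : ∀ p ∈ Metric.closedBall X r, ∀ t ∈ Icc 0 h, p + t • e ∈ Metric.closedBall X (2 * r) := by
    intro p hp t ht
    rw [Metric.mem_closedBall, dist_eq_norm] at *
    calc ‖p + t • e - X‖ = ‖(p - X) + t • e‖ := by congr 1; abel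
      _ ≤ ‖p - X‖ + ‖t • e‖ := norm_add_le _ _
      _ ≤ r + h * ‖e‖ := by
        rw [norm_smul, Real.norm_of_nonneg ht.1]
        gcongr
        exact ht.2
      _ ≤ 2 * r := by linarith
  have hder : ∀ p ∈ Metric.closedBall X r, ∀ t ∈ Icc 0 h,
      HasDerivAt (fun s : ℝ => W (p + s • e)) (We (p + t • e)) t := by
    intro p hp t ht
    have h1 := hWd _ (hsubO (hin p hp t ht))
    have h2 : HasDerivAt (fun s : ℝ => W (p + t • e + s • e)) (We (p + t • e)) (t - t) := by
      simpa using h1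
    have h3 := h2.comp_sub_const t t
    refine h3.congr_of_eventuallyEq (Eventually.of_forall fun s => ?_)
    simp only
    congr 1
    rw [add_assoc, ← add_smul]; congr 2; ring
  have hq : ∀ p ∈ Metric.closedBall X r, |h⁻¹ * (W (p + h • e) - W p) - We p| < r ^ 4 / 2 := by
    intro p hp
    obtain ⟨ξ, hξ, hξ'⟩ := exists_hasDerivAt_eq_slope (fun s : ℝ => W (p + s • e))
      (fun t => We (p + t • e)) hh
      (fun t ht => (hder p hp t ht).continuousAt.continuousWithinAt)
      (fun t ht => hder p hp t (Ioo_subset_Icc_self ht))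
    have h1 : h⁻¹ * (W (p + h • e) - W p) = We (p + ξ • e) := by
      rw [hξ']; simp; ring
    rw [h1, ← Real.dist_eq]
    refine huc _ (hin p hp ξ (Ioo_subset_Icc_self hξ)) p ?_ ?_
    · simpa using hin p hp 0 ⟨le_rfl, hh.le⟩
    · rw [dist_eq_norm, add_sub_cancel_left, norm_smul, Real.norm_of_nonneg hξ.1.le]
      exact lt_of_le_of_lt (mul_le_mul_of_nonneg_right hξ.2.le (norm_nonneg e)) hh1
  set E : ℝ × ℝ → ℝ := fun p => h⁻¹ * (W (p + h • e) - W p) - ψ p - N p with hE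
  have hEc : ContinuousOn E (Metric.closedBall X r) := by
    have hsub1 : Metric.closedBall X r ⊆ O := 
      (Metric.closedBall_subset_closedBall (by linarith)).trans hsubO
    refine ((continuousOn_const.mul (ContinuousOn.sub ?_ (hWc.mono hsub1))).sub
      (hψc.mono hsub1)).sub ?_
    · refine hWc.comp (by fun_prop) fun p hp => hsubO (hin p hp h ⟨hh.le, le_rfl⟩)
    · apply Continuous.continuousOn; fun_prop
  obtain ⟨P, hP, hPmax⟩ := (isCompact_closedBall X r).exists_isMaxOn
    ⟨X, Metric.mem_closedBall_self hrp.le⟩ hEc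
  have hEX := hPmax (Metric.mem_closedBall_self hrp.le)
  have hqX := abs_lt.1 (hq X (Metric.mem_closedBall_self hrp.le))
  have hqP := abs_lt.1 (hq P hP)
  have hmP := (hball P (hsub (Metric.closedBall_subset_closedBall (by linarith) hP))).2
  have hPin : P ∈ Metric.ball X r := by
    by_contra hn
    have hd : dist P X = r := le_antisymm hP (not_lt.1 hn)
    have hNr : r ^ 4 ≤ N P := by
      rw [Prod.dist_eq] at hd
      have e4 : ∀ x : ℝ, |x| ^ 4 = x ^ 4 := fun x => by
        rw [show (4:ℕ) = 2 * 2 by norm_num, pow_mul, pow_mul, sq_abs]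
      rcases max_choice (dist P.1 X.1) (dist P.2 X.2) with h | h <;> rw [h, Real.dist_eq] at hd
      · simp only [hN]
        rw [← hd, e4]
        have : 0 ≤ (P.2 - X.2) ^ 4 := by positivity
        linarith
      · simp only [hN]
        rw [← hd, e4]
        have : 0 ≤ (P.1 - X.1) ^ 4 := by positivity
        linarith
    have hNX : N X = 0 := by simp [hN]
    simp only [hE, mem_ofPred_eq] at hEX
    rw [hNX] at hEX
    simp only at hmP
    linarith
  have hloc : IsLocalMax E P := by
    filter_upwards [Metric.isOpen_ball.mem_nhds hPin] with q hq
    exact hPmax (Metric.ball_subset_closedBall hq)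
  have hME : MEq γ E P (h⁻¹ * (0 - 0) - L P - LN P) := by
    have hPO : P ∈ O := hsubO (Metric.closedBall_subset_closedBall (by linarith) hP)
    exact (((MEq.shift (hWM _ (hsubO (hin P hP h ⟨hh.le, le_rfl⟩)))).sub
      (hWM P hPO)).const_mul _ |>.sub (hψ P hPO)).sub (hNM P)
  have := hME.nonpos hloc
  have := (hball P (hsub (Metric.closedBall_subset_closedBall (by linarith) hP))).1.1
  linarith


/-- open region -/
def Om (φ : ℝ → ℝ) : Set (ℝ × ℝ) := {p | p.2 < 0 ∧ p.1 < φ p.2}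
/-- region with the free boundary -/
def Cl (φ : ℝ → ℝ) : Set (ℝ × ℝ) := {p | p.2 < 0 ∧ p.1 ≤ φ p.2}

structure Pkg (γ M lam : ℝ) (W a b : ℝ × ℝ → ℝ) (φ φ' : ℝ → ℝ) : Prop where
  hγ : 1 < γ
  hlam : 0 < lam
  Wc : ContinuousOn W (Cl φ)
  ac : ContinuousOn a (Cl φ)
  bc : ContinuousOn b (Cl φ)
  hW : ∀ p ∈ Om φ, HasFDerivAt W (a p • ContinuousLinearMap.fst ℝ ℝ ℝ + b p • ContinuousLinearMap.snd ℝ ℝ ℝ) p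
  aC : ContDiffOn ℝ 1 a (Om φ)
  bC : ContDiffOn ℝ 1 b (Om φ)
  pde : ∀ p ∈ Om φ, fderiv ℝ a p (1, 0) + fderiv ℝ b p (0, 1) = γ * a p
  apos : ∀ p ∈ Om φ, 0 < a p
  Wpos : ∀ p ∈ Cl φ, 0 < W p
  Wle : ∀ p ∈ Cl φ, W p ≤ 1
  Wbd : ∀ y < 0, W (φ y, y) = 1
  gbd : ∀ y < 0, a (φ y, y) ^ 2 + b (φ y, y) ^ 2 = 1
  dφ : ∀ y < 0, HasDerivAt φ (φ' y) y
  φ'c : ContDiffOn ℝ 1 φ' (Iio 0)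
  Mφ : ∀ y < 0, M < φ y
  decay : ∀ x ≤ M, ∀ y < 0, W (x, y) ≤ Real.exp (lam * (x - M))

namespace Pkg
variable {γ M lam : ℝ} {W a b : ℝ × ℝ → ℝ} {φ φ' : ℝ → ℝ}

lemma φc (P : Pkg γ M lam W a b φ φ') : ContinuousOn φ (Iio 0) :=
  fun y hy => (P.dφ y hy).continuousAt.continuousWithinAt

lemma openOm (P : Pkg γ M lam W a b φ φ') : IsOpen (Om φ) := by
  rw [isOpen_iff_mem_nhds]
  rintro p ⟨h1, h2⟩
  have hc : ContinuousAt (fun q : ℝ × ℝ => φ q.2 - q.1) p :=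
    ((P.dφ p.2 h1).continuousAt.comp continuousAt_snd).sub continuousAt_fst
  filter_upwards [hc.eventually (lt_mem_nhds (sub_pos.2 h2)),
    continuousAt_snd.eventually (gt_mem_nhds h1)] with q hq hq'
  exact ⟨hq', sub_pos.1 hq⟩

lemma Om_sub (φ : ℝ → ℝ) : Om φ ⊆ Cl φ := fun _ hp => ⟨hp.1, hp.2.le⟩

lemma adiff (P : Pkg γ M lam W a b φ φ') {p : ℝ × ℝ} (hp : p ∈ Om φ) : DifferentiableAt ℝ a p :=
  (P.aC.contDiffAt (P.openOm.mem_nhds hp)).differentiableAt one_ne_zero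

lemma bdiff (P : Pkg γ M lam W a b φ φ') {p : ℝ × ℝ} (hp : p ∈ Om φ) : DifferentiableAt ℝ b p :=
  (P.bC.contDiffAt (P.openOm.mem_nhds hp)).differentiableAt one_ne_zero

lemma H2x (P : Pkg γ M lam W a b φ φ') {p : ℝ × ℝ} (hp : p ∈ Om φ) :
    H2 (fun t => W (t, p.2)) p.1 (a p) (fderiv ℝ a p (1, 0)) := by
  have hl : ∀ t : ℝ, HasDerivAt (fun t : ℝ => (t, p.2)) ((1 : ℝ), (0 : ℝ)) t := fun t =>
    (hasDerivAt_id t).prodMk (hasDerivAt_const t p.2)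
  refine ⟨fun t => a (t, p.2), ?_, rfl, ?_⟩
  · have : ∀ᶠ t in 𝓝 p.1, (t, p.2) ∈ Om φ :=
      (hl p.1).continuousAt.eventually (P.openOm.mem_nhds hp)
    filter_upwards [this] with t ht
    have := (P.hW _ ht).comp_hasDerivAt t (hl t)
    exact this.congr_deriv (by simp)
  · exact (P.adiff hp).hasFDerivAt.comp_hasDerivAt p.1 (hl p.1)

lemma H2y (P : Pkg γ M lam W a b φ φ') {p : ℝ × ℝ} (hp : p ∈ Om φ) :
    H2 (fun t => W (p.1, t)) p.2 (b p) (fderiv ℝ b p (0, 1)) := by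
  have hl : ∀ t : ℝ, HasDerivAt (fun t : ℝ => (p.1, t)) ((0 : ℝ), (1 : ℝ)) t := fun t =>
    (hasDerivAt_const t p.1).prodMk (hasDerivAt_id t)
  refine ⟨fun t => b (p.1, t), ?_, rfl, ?_⟩
  · have : ∀ᶠ t in 𝓝 p.2, (p.1, t) ∈ Om φ :=
      (hl p.2).continuousAt.eventually (P.openOm.mem_nhds hp)
    filter_upwards [this] with t ht
    have := (P.hW _ ht).comp_hasDerivAt t (hl t)
    exact this.congr_deriv (by simp)
  · exact (P.bdiff hp).hasFDerivAt.comp_hasDerivAt p.2 (hl p.2)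

lemma H2_bar {R x0 C t : ℝ} (hp : 0 < C - (t - x0) ^ 2) :
    H2 (fun s => R ^ 2 / (C - (s - x0) ^ 2) ^ 2) t (4 * R ^ 2 * (t - x0) / (C - (t - x0) ^ 2) ^ 3)
      (4 * R ^ 2 / (C - (t - x0) ^ 2) ^ 3 + 24 * R ^ 2 * (t - x0) ^ 2 / (C - (t - x0) ^ 2) ^ 4) := by
  have hd : ∀ s, HasDerivAt (fun s => C - (s - x0) ^ 2) (-(2 * (s - x0))) s := by
    intro s
    have := (((hasDerivAt_id s).sub_const x0).pow 2).const_sub C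
    exact this.congr_deriv (by simp)
  refine ⟨fun s => 4 * R ^ 2 * (s - x0) / (C - (s - x0) ^ 2) ^ 3, ?_, rfl, ?_⟩
  · filter_upwards [(hd t).continuousAt.eventually (lt_mem_nhds hp)] with s hs
    have := (hasDerivAt_const s (R ^ 2)).div ((hd s).pow 2) (pow_ne_zero _ hs.ne')
    refine this.congr_deriv ?_
    simp only [Pi.pow_apply]
    field_simp
    simp
    ring
  · have := (((hasDerivAt_id t).sub_const x0).const_mul (4 * R ^ 2)).div ((hd t).pow 3) (pow_ne_zero _ hp.ne')
    refine this.congr_deriv ?_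
    simp only [Pi.pow_apply, id]
    set q := C - (t - x0) ^ 2
    field_simp
    norm_num
    ring

/-- the barrier function -/
def Hb (R : ℝ) (X p : ℝ × ℝ) : ℝ := R ^ 2 / (R ^ 2 - (p.1 - X.1) ^ 2 - (p.2 - X.2) ^ 2) ^ 2

lemma final_ineq {γ η k s g A R T Hx : ℝ} (hγ : 1 < γ) (hη : η = 1 / (32 * (γ + 2)))
    (hk : 0 < k) (hs : 0 < s) (hs1 : s ≤ 1) (hA : A = 1 / η ^ 2) (hR : 1 / η ≤ R)
    (hg : s ^ 2 + A * (s * k ^ 2 - s ^ 2 / R ^ 2) < g * s ^ 2) (hkR : 1 / R ^ 2 ≤ k ^ 2)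
    (hT : T ≤ 32 * k ^ 4) (hHx : |Hx| ≤ 4 * k ^ 3) :
    - (k ^ 2 * g ^ 2 / 4) + g * (4 * k ^ 3) + T - γ * Hx < 0 := by
  have hη0 : 0 < η := by rw [hη]; positivity
  have hR0 : 0 < R := lt_of_lt_of_le (by positivity) hR
  have hA0 : 0 < A := by rw [hA]; positivity
  have h1 : k ^ 2 ≤ η ^ 2 * g ∧ 1 < g := by
    have h2 : s ^ 2 * (1 + A * (k ^ 2 - 1 / R ^ 2)) < s ^ 2 * g := by
      have : s ^ 2 * k ^ 2 ≤ s * k ^ 2 := by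
        have : s ^ 2 ≤ s := by nlinarith
        gcongr
      have h3 : A * (s ^ 2 * k ^ 2) ≤ A * (s * k ^ 2) := by gcongr
      have e : s ^ 2 / R ^ 2 = s ^ 2 * (1 / R ^ 2) := by ring
      rw [e] at hg
      nlinarith
    have h3 : 1 + A * (k ^ 2 - 1 / R ^ 2) < g := lt_of_mul_lt_mul_left h2 (by positivity)
    have h4 : 0 ≤ A * (k ^ 2 - 1 / R ^ 2) := mul_nonneg hA0.le (by linarith)
    have h5 : 1 / R ^ 2 ≤ η ^ 2 := by
      have : 1 / R ≤ η := by rw [div_le_comm₀ hR0 hη0]; exact hR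
      calc 1 / R ^ 2 = (1 / R) ^ 2 := by ring
        _ ≤ η ^ 2 := by gcongr
    have h6 : η ^ 2 * A = 1 := by rw [hA]; field_simp
    refine ⟨?_, by linarith⟩
    have h7 : η ^ 2 * (1 + A * (k ^ 2 - 1 / R ^ 2)) < η ^ 2 * g := by gcongr
    have h8 : η ^ 2 * (1 + A * (k ^ 2 - 1 / R ^ 2)) = η ^ 2 + η ^ 2 * A * (k ^ 2 - 1 / R ^ 2) := by ring
    rw [h8, h6] at h7
    linarith
  obtain ⟨h1, hg1⟩ := h1
  have hkg : k ≤ η * g := by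
    have : k ^ 2 ≤ (η * g) ^ 2 := by
      have : η ^ 2 * g ≤ η ^ 2 * g ^ 2 := by gcongr; nlinarith
      rw [mul_pow]; linarith
    exact (pow_le_pow_iff_left₀ hk.le (by positivity) two_ne_zero).1 this
  have hγη : η * (γ + 2) = 1 / 32 := by rw [hη]; field_simp
  have hη1 : η ≤ 1 / 96 := by nlinarith
  have hHx' := (abs_le.1 hHx).1
  have h9 : - (k ^ 2 * g ^ 2 / 4) + g * (4 * k ^ 3) + T - γ * Hx ≤
      k ^ 2 * (-g ^ 2 / 4 + 4 * g * k + 32 * k ^ 2 + 4 * γ * k) := by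
    have : γ * (-(4 * k ^ 3)) ≤ γ * Hx := by gcongr
    nlinarith
  refine lt_of_le_of_lt h9 ?_
  apply mul_neg_of_pos_of_neg (by positivity)
  have i1 : 4 * g * k ≤ 4 * g * (η * g) := by gcongr
  have i2 : 32 * k ^ 2 ≤ 32 * (η * g) ^ 2 := by gcongr
  have i3 : 4 * γ * k ≤ 4 * γ * (η * g ^ 2) := by
    have : η * g ≤ η * g ^ 2 := by gcongr; nlinarith
    gcongr; linarith
  have i4 : η ^ 2 ≤ 1 / 96 * (1 / 96) := by nlinarith
  have i5 : 32 * (η * g) ^ 2 ≤ 32 * (1 / 96 * (1 / 96)) * g ^ 2 := by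
    rw [mul_pow]; nlinarith [sq_nonneg g]
  have i6 : 4 * g * (η * g) + 4 * γ * (η * g ^ 2) = 4 * (η * (γ + 2)) * g ^ 2 - 4 * η * g ^ 2 := by ring
  rw [hγη] at i6
  have : 0 < g ^ 2 := by positivity
  nlinarith

end Pkg


namespace Pkg
variable {γ M lam : ℝ} {W a b : ℝ × ℝ → ℝ} {φ φ' : ℝ → ℝ}

lemma MEq_bar (P : Pkg γ M lam W a b φ φ') {R A : ℝ} {X p : ℝ × ℝ} (hp : p ∈ Om φ)
    (hq : 0 < R ^ 2 - (p.1 - X.1) ^ 2 - (p.2 - X.2) ^ 2) :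
    MEq γ (fun p => W p + (A * (√(W p) * Hb R X p) - (A / R ^ 2) * W p)) p
      (A * (- (a p ^ 2 + b p ^ 2) / (4 * W p * √(W p)) * Hb R X p
        + (a p * (4 * R ^ 2 * (p.1 - X.1) / (R ^ 2 - (p.1 - X.1) ^ 2 - (p.2 - X.2) ^ 2) ^ 3)
          + b p * (4 * R ^ 2 * (p.2 - X.2) / (R ^ 2 - (p.1 - X.1) ^ 2 - (p.2 - X.2) ^ 2) ^ 3)) / √(W p)
        + √(W p) * (8 * R ^ 2 / (R ^ 2 - (p.1 - X.1) ^ 2 - (p.2 - X.2) ^ 2) ^ 3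
           + 24 * R ^ 2 * ((p.1 - X.1) ^ 2 + (p.2 - X.2) ^ 2) / (R ^ 2 - (p.1 - X.1) ^ 2 - (p.2 - X.2) ^ 2) ^ 4
           - γ * (4 * R ^ 2 * (p.1 - X.1) / (R ^ 2 - (p.1 - X.1) ^ 2 - (p.2 - X.2) ^ 2) ^ 3)))) := by
  have hWp := P.Wpos p (Om_sub φ hp)
  have hs : 0 < √(W p) := Real.sqrt_pos.2 hWp
  have hpde := P.pde p hp
  have hx := P.H2x hp
  have hy := P.H2y hp
  have hM : MEq γ W p 0 := ⟨_, _, _, _, hx, hy, by linarith⟩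
  have e1 : R ^ 2 - (p.1 - X.1) ^ 2 - (p.2 - X.2) ^ 2 = (R ^ 2 - (p.2 - X.2) ^ 2) - (p.1 - X.1) ^ 2 := by ring
  have e2 : R ^ 2 - (p.1 - X.1) ^ 2 - (p.2 - X.2) ^ 2 = (R ^ 2 - (p.1 - X.1) ^ 2) - (p.2 - X.2) ^ 2 := by ring
  have bx : H2 (fun t => Hb R X (t, p.2)) p.1 
      (4 * R ^ 2 * (p.1 - X.1) / (R ^ 2 - (p.1 - X.1) ^ 2 - (p.2 - X.2) ^ 2) ^ 3)
      (4 * R ^ 2 / (R ^ 2 - (p.1 - X.1) ^ 2 - (p.2 - X.2) ^ 2) ^ 3 + 24 * R ^ 2 * (p.1 - X.1) ^ 2 / (R ^ 2 - (p.1 - X.1) ^ 2 - (p.2 - X.2) ^ 2) ^ 4) := by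
    have := H2_bar (R := R) (x0 := X.1) (C := R ^ 2 - (p.2 - X.2) ^ 2) (t := p.1) (by linarith)
    rw [e1]
    convert this using 1
    ext t
    simp only [Hb]
    congr 2; ring
  have bY : H2 (fun t => Hb R X (p.1, t)) p.2 
      (4 * R ^ 2 * (p.2 - X.2) / (R ^ 2 - (p.1 - X.1) ^ 2 - (p.2 - X.2) ^ 2) ^ 3)
      (4 * R ^ 2 / (R ^ 2 - (p.1 - X.1) ^ 2 - (p.2 - X.2) ^ 2) ^ 3 + 24 * R ^ 2 * (p.2 - X.2) ^ 2 / (R ^ 2 - (p.1 - X.1) ^ 2 - (p.2 - X.2) ^ 2) ^ 4) :=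
    H2_bar (R := R) (x0 := X.2) (C := R ^ 2 - (p.1 - X.1) ^ 2) (t := p.2) (by linarith)
  have hS : MEq γ (fun p => √(W p) * Hb R X p) p 
     (- (a p ^ 2 + b p ^ 2) / (4 * W p * √(W p)) * Hb R X p
        + (a p * (4 * R ^ 2 * (p.1 - X.1) / (R ^ 2 - (p.1 - X.1) ^ 2 - (p.2 - X.2) ^ 2) ^ 3)
          + b p * (4 * R ^ 2 * (p.2 - X.2) / (R ^ 2 - (p.1 - X.1) ^ 2 - (p.2 - X.2) ^ 2) ^ 3)) / √(W p)
        + √(W p) * (8 * R ^ 2 / (R ^ 2 - (p.1 - X.1) ^ 2 - (p.2 - X.2) ^ 2) ^ 3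
           + 24 * R ^ 2 * ((p.1 - X.1) ^ 2 + (p.2 - X.2) ^ 2) / (R ^ 2 - (p.1 - X.1) ^ 2 - (p.2 - X.2) ^ 2) ^ 4
           - γ * (4 * R ^ 2 * (p.1 - X.1) / (R ^ 2 - (p.1 - X.1) ^ 2 - (p.2 - X.2) ^ 2) ^ 3))) := by
    refine ⟨_, _, _, _, (hx.sqrt hWp).mul bx, (hy.sqrt hWp).mul bY, ?_⟩
    have e3 : fderiv ℝ b p (0, 1) = γ * a p - fderiv ℝ a p (1, 0) := by linarith
    simp only [Prod.mk.eta]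
    rw [e3]
    generalize R ^ 2 - (p.1 - X.1) ^ 2 - (p.2 - X.2) ^ 2 = q at *
    generalize Hb R X p = h at *
    field_simp
    ring
  have := hM.add ((hS.const_mul A).sub (hM.const_mul (A / R ^ 2)))
  simpa using this

set_option maxHeartbeats 1000000 in
lemma key (P : Pkg γ M lam W a b φ φ') : ∃ A Y0 : ℝ, 0 < A ∧ 0 < Y0 ∧ ∀ X ∈ Om φ, X.2 ≤ -Y0 →
    √(a X ^ 2 + b X ^ 2) ≤ W X + A * (√(W X) - W X) / X.2 ^ 2 := by
  have hγ := P.hγ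
  obtain ⟨η, hη⟩ : ∃ η, η = 1 / (32 * (γ + 2)) := ⟨_, rfl⟩
  have hη0 : 0 < η := by rw [hη]; positivity
  obtain ⟨A, hA⟩ : ∃ A, A = 1 / η ^ 2 := ⟨_, rfl⟩
  have hA0 : 0 < A := by rw [hA]; positivity
  refine ⟨4 * A, 2 / η, by positivity, by positivity, fun X hX hXY => ?_⟩
  obtain ⟨R, hR⟩ : ∃ R, R = -X.2 / 2 := ⟨_, rfl⟩
  have hRη : 1 / η ≤ R := by
    rw [hR]
    have : 2 / η = 2 * (1 / η) := by ring
    linarith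
  have hR0 : 0 < R := lt_of_lt_of_le (by positivity) hRη
  have hXR : X.2 = -2 * R := by linarith
  have hWX := P.Wpos X (Om_sub φ hX)
  by_contra! hcon
  -- the compact set
  set q : ℝ × ℝ → ℝ := fun p => (p.1 - X.1) ^ 2 + (p.2 - X.2) ^ 2 with hq
  have hqc : Continuous q := by fun_prop
  have hKR : ∀ r, r ≤ R ^ 2 → IsCompact {p : ℝ × ℝ | q p ≤ r ∧ p.1 ≤ φ p.2} ∧ 
      {p : ℝ × ℝ | q p ≤ r ∧ p.1 ≤ φ p.2} ⊆ Cl φ := by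
    intro r hr
    have hneg : ∀ p, q p ≤ r → p.2 < 0 := by
      intro p hp
      have h1 : (p.2 - X.2) ^ 2 ≤ R ^ 2 := by
        have : 0 ≤ (p.1 - X.1) ^ 2 := sq_nonneg _
        simp only [hq] at hp; linarith
      have := abs_le_of_sq_le_sq' h1 hR0.le
      linarith [this.2]
    refine ⟨?_, fun p hp => ⟨hneg p hp.1, hp.2⟩⟩
    have hK0 : IsCompact {p : ℝ × ℝ | q p ≤ r} := by
      refine (isCompact_closedBall X R).of_isClosed_subset (isClosed_le hqc continuous_const) ?_
      intro p hp
      rw [Metric.mem_closedBall, Prod.dist_eq, Real.dist_eq, Real.dist_eq]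
      have h1 : q p ≤ R ^ 2 := le_trans hp hr
      simp only [hq] at h1
      refine max_le ?_ ?_
      · exact abs_le_of_sq_le_sq (by linarith [sq_nonneg (p.2 - X.2)]) hR0.le
      · exact abs_le_of_sq_le_sq (by linarith [sq_nonneg (p.1 - X.1)]) hR0.le
    have hcl : IsClosed ({p : ℝ × ℝ | q p ≤ r} ∩ (fun p : ℝ × ℝ => φ p.2 - p.1) ⁻¹' Ici 0) := by
      refine ContinuousOn.preimage_isClosed_of_isClosed ?_ hK0.isClosed isClosed_Ici
      refine ContinuousOn.sub (P.φc.comp continuousOn_snd fun p hp => hneg p hp) continuousOn_fst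
    refine hK0.of_isClosed_subset ?_ (fun p hp => hp.1)
    convert hcl using 1
    ext p
    simp [sub_nonneg]
  have hgc : ContinuousOn (fun p => √(a p ^ 2 + b p ^ 2)) (Cl φ) :=
    ((P.ac.pow 2).add (P.bc.pow 2)).sqrt
  obtain ⟨hK, hKC⟩ := hKR (R ^ 2) le_rfl
  obtain ⟨B, hB⟩ := hK.bddAbove_image (hgc.mono hKC)
  have hXK : X ∈ {p : ℝ × ℝ | q p ≤ R ^ 2 ∧ p.1 ≤ φ p.2} := ⟨by simp [hq]; positivity, hX.2.le⟩
  have hB' : ∀ p, q p ≤ R ^ 2 → p.1 ≤ φ p.2 → √(a p ^ 2 + b p ^ 2) ≤ B := fun p h1 h2 =>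
    hB (mem_image_of_mem _ ⟨h1, h2⟩)
  have hB0 : 0 ≤ B := (Real.sqrt_nonneg _).trans (hB' X hXK.1 hXK.2)
  obtain ⟨pm, hpm, hmin⟩ := hK.exists_isMinOn ⟨X, hXK⟩ (P.Wc.mono hKC).sqrt
  obtain ⟨m, hm⟩ : ∃ m, m = √(W pm) := ⟨_, rfl⟩
  have hm0 : 0 < m := by rw [hm]; exact Real.sqrt_pos.2 (P.Wpos _ (hKC hpm))
  have hmin' : ∀ p, q p ≤ R ^ 2 → p.1 ≤ φ p.2 → m ≤ √(W p) := fun p h1 h2 => by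
    rw [hm]; exact hmin ⟨h1, h2⟩
  -- choose tau
  obtain ⟨n, hn⟩ : ∃ n, n = R ^ 2 * (B + 1) / (A * m) := ⟨_, rfl⟩
  have hn0 : 0 < n := by rw [hn]; positivity
  obtain ⟨τ, hτ⟩ : ∃ τ, τ = R ^ 2 / (n + 1) := ⟨_, rfl⟩
  have hτ0 : 0 < τ := by rw [hτ]; positivity
  have hτR : τ < R ^ 2 := by
    rw [hτ, div_lt_iff₀ (by positivity)]
    have : 0 < R ^ 2 * n := by positivity
    rw [mul_add, mul_one]; linarith
  have hτB : B + 1 ≤ A * m * (R ^ 2 / τ ^ 2 - 1 / R ^ 2) := by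
    have h1 : R ^ 2 / τ ^ 2 - 1 / R ^ 2 = (n ^ 2 + 2 * n) / R ^ 2 := by
      rw [hτ]; field_simp; ring
    have h2 : A * m * (n / R ^ 2) = B + 1 := by rw [hn]; field_simp
    rw [h1, ← h2]
    gcongr
    have : 0 ≤ n ^ 2 := sq_nonneg n
    linarith
  obtain ⟨hK1, hK1C⟩ := hKR (R ^ 2 - τ) (by linarith)
  set ψ : ℝ × ℝ → ℝ := fun p => W p + (A * (√(W p) * Hb R X p) - (A / R ^ 2) * W p) with hψ
  have hden : ∀ p, R ^ 2 - (p.1 - X.1) ^ 2 - (p.2 - X.2) ^ 2 = R ^ 2 - q p := fun p => by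
    simp only [hq]; ring
  have hq0 : ∀ p, 0 ≤ q p := fun p => by simp only [hq]; positivity
  have hHc : ContinuousOn (Hb R X) {p | q p ≤ R ^ 2 - τ} := by
    unfold Hb
    refine ContinuousOn.div continuousOn_const (by fun_prop) fun p hp => ?_
    rw [hden]
    have : q p ≤ R ^ 2 - τ := hp
    have : 0 < R ^ 2 - q p := by linarith
    positivity
  have hψc : ContinuousOn ψ {p : ℝ × ℝ | q p ≤ R ^ 2 - τ ∧ p.1 ≤ φ p.2} := by
    have hWc := P.Wc.mono hK1C
    exact hWc.add ((continuousOn_const.mul (hWc.sqrt.mul (hHc.mono fun p hp => hp.1))).sub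
      (continuousOn_const.mul hWc))
  have hHge : ∀ p, q p ≤ R ^ 2 - τ → 1 / R ^ 2 ≤ Hb R X p := by
    intro p hp
    unfold Hb
    rw [hden, div_le_div_iff₀ (by positivity) (by have : 0 < R ^ 2 - q p := by linarith
                                                  positivity)]
    have h1 : R ^ 2 - q p ≤ R ^ 2 := by linarith [hq0 p]
    have h2 : 0 < R ^ 2 - q p := by linarith
    rw [one_mul, sq (R ^ 2 - q p)]
    exact mul_le_mul h1 h1 h2.le (by positivity)
  have hXK1 : X ∈ {p : ℝ × ℝ | q p ≤ R ^ 2 - τ ∧ p.1 ≤ φ p.2} := 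
    ⟨by simp [hq]; linarith, hX.2.le⟩
  obtain ⟨Z, hZ, hZmax⟩ := hK1.exists_isMaxOn ⟨X, hXK1⟩ ((hgc.mono hK1C).sub hψc)
  have hZX := hZmax hXK1
  simp only [mem_ofPred_eq] at hZX
  have hHX : Hb R X X = 1 / R ^ 2 := by
    unfold Hb; simp; field_simp
  have hpos : 0 < √(a X ^ 2 + b X ^ 2) - ψ X := by
    simp only [hψ, hHX]
    have : 4 * A * (√(W X) - W X) / X.2 ^ 2 = A * (√(W X) * (1 / R ^ 2)) - A / R ^ 2 * W X := by
      rw [hXR]; field_simp; ring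
    linarith
  have hZpos : 0 < √(a Z ^ 2 + b Z ^ 2) - ψ Z := lt_of_lt_of_le hpos hZX
  have hWZ := P.Wpos Z (hK1C hZ)
  have hWZ1 := P.Wle Z (hK1C hZ)
  obtain ⟨s, hs⟩ : ∃ s, s = √(W Z) := ⟨_, rfl⟩
  have hs0 : 0 < s := by rw [hs]; exact Real.sqrt_pos.2 hWZ
  have hsW : W Z = s ^ 2 := by rw [hs, Real.sq_sqrt hWZ.le]
  have hs1 : s ≤ 1 := by rw [hs]; exact Real.sqrt_le_one.2 hWZ1
  have hψZ : ψ Z = s ^ 2 + A * (s * Hb R X Z - s ^ 2 / R ^ 2) := by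
    simp only [hψ]; rw [← hs, hsW]; ring
  have hHZ := hHge Z hZ.1
  have hss : s ^ 2 ≤ s := by rw [sq]; exact mul_le_of_le_one_left hs0.le hs1
  have hψZ2 : s ^ 2 + A * s * (Hb R X Z - 1 / R ^ 2) ≤ ψ Z := by
    rw [hψZ]
    have : A * (s ^ 2 / R ^ 2) ≤ A * (s / R ^ 2) := by gcongr
    have e : A * s * (Hb R X Z - 1 / R ^ 2) = A * (s * Hb R X Z) - A * (s / R ^ 2) := by ring
    linarith
  -- not on the sphere
  have hZ1 : q Z < R ^ 2 - τ := by
    refine lt_of_le_of_ne hZ.1 fun h => ?_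
    have h1 : Hb R X Z = R ^ 2 / τ ^ 2 := by unfold Hb; rw [hden, h]; congr 2; ring
    rw [h1] at hψZ2
    have h2 := hmin' Z (by linarith [hZ.1]) hZ.2
    rw [← hs] at h2
    have h3 : A * m * (R ^ 2 / τ ^ 2 - 1 / R ^ 2) ≤ A * s * (R ^ 2 / τ ^ 2 - 1 / R ^ 2) := by
      rw [h1] at hHZ
      have : 0 ≤ R ^ 2 / τ ^ 2 - 1 / R ^ 2 := by linarith
      gcongr
    have h4 := hB' Z (by linarith [hZ.1]) hZ.2
    have : 0 < s ^ 2 := by positivity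
    linarith
  -- not on the free boundary
  have hZ2 : Z.1 < φ Z.2 := by
    refine lt_of_le_of_ne hZ.2 fun h => ?_
    have hZn := (hK1C hZ).1
    have e : Z = (φ Z.2, Z.2) := by rw [← h]
    have h1 := P.Wbd Z.2 hZn
    have h2 := P.gbd Z.2 hZn
    rw [← e] at h1 h2
    rw [h2, Real.sqrt_one] at hZpos
    have : 0 ≤ A * s * (Hb R X Z - 1 / R ^ 2) := mul_nonneg (by positivity) (by linarith)
    rw [← hsW, h1] at hψZ2
    linarith
  have hZn := (hK1C hZ).1
  have hZO : Z ∈ Om φ := ⟨hZn, hZ2⟩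
  obtain ⟨G, hG⟩ : ∃ G, G = √(a Z ^ 2 + b Z ^ 2) := ⟨_, rfl⟩
  have hψZ0 : 0 < ψ Z := by
    have : 0 ≤ A * s * (Hb R X Z - 1 / R ^ 2) := mul_nonneg (by positivity) (by linarith)
    have : 0 < s ^ 2 := by positivity
    linarith
  rw [← hG] at hZpos
  have hG0 : 0 < G := by linarith
  have hG2 : G ^ 2 = a Z ^ 2 + b Z ^ 2 := by rw [hG, Real.sq_sqrt (by positivity)]
  set O : Set (ℝ × ℝ) := Om φ ∩ {p | q p < R ^ 2 - τ} with hO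
  have hOo : IsOpen O := P.openOm.inter (isOpen_lt hqc continuous_const)
  have hOK : O ⊆ {p : ℝ × ℝ | q p ≤ R ^ 2 - τ ∧ p.1 ≤ φ p.2} := fun p hp => ⟨le_of_lt hp.2, hp.1.2.le⟩
  have hOC : O ⊆ Cl φ := hOK.trans hK1C
  have hZin : Z ∈ O := ⟨hZO, hZ1⟩
  have hcW : ContinuousAt W Z := (P.hW Z hZO).continuousAt
  have hca : ContinuousAt a Z := (P.adiff hZO).continuousAt
  have hcb : ContinuousAt b Z := (P.bdiff hZO).continuousAt
  have hQ : 0 < R ^ 2 - (Z.1 - X.1) ^ 2 - (Z.2 - X.2) ^ 2 := by rw [hden]; linarith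
  have hL := visc (γ := γ) (W := W) (We := fun p => a Z / G * a p + b Z / G * b p) (ψ := ψ)
    (e := (a Z / G, b Z / G)) hOo hZin (P.Wc.mono hOC)
    ((continuousOn_const.mul (P.ac.mono hOC)).add (continuousOn_const.mul (P.bc.mono hOC)))
    (fun p hp => by
      have hl : HasDerivAt (fun t : ℝ => p + t • (a Z / G, b Z / G)) (a Z / G, b Z / G) 0 := by
        have := ((hasDerivAt_id (0:ℝ)).smul_const (a Z / G, b Z / G)).const_add p
        exact this.congr_deriv (by simp)
      have h1 := P.hW p hp.1
      have h2 : HasFDerivAt W (a p • ContinuousLinearMap.fst ℝ ℝ ℝ + b p • ContinuousLinearMap.snd ℝ ℝ ℝ)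
        (p + (0:ℝ) • (a Z / G, b Z / G)) := by simpa using h1
      exact (h2.comp_hasDerivAt (0:ℝ) hl).congr_deriv (by simp; ring))
    (fun p hp => ⟨_, _, _, _, P.H2x hp.1, P.H2y hp.1, by linarith [P.pde p hp.1]⟩)
    (hψc.mono hOK)
    (fun p hp => P.MEq_bar hp.1 (by rw [hden]; have : q p < R ^ 2 - τ := hp.2
                                    linarith))
    (by
      have hsq : ContinuousAt (fun p => √(W p)) Z := hcW.sqrt
      have hqa : ContinuousAt (fun p : ℝ × ℝ => R ^ 2 - (p.1 - X.1) ^ 2 - (p.2 - X.2) ^ 2) Z := by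
        apply Continuous.continuousAt; fun_prop
      have hHa : ContinuousAt (Hb R X) Z := continuousAt_const.div (hqa.pow 2) (pow_ne_zero _ hQ.ne')
      have hx1 : ContinuousAt (fun p : ℝ × ℝ => p.1 - X.1) Z := by
        apply Continuous.continuousAt; fun_prop
      have hx2 : ContinuousAt (fun p : ℝ × ℝ => p.2 - X.2) Z := by
        apply Continuous.continuousAt; fun_prop
      have hs3 : √(W Z) ≠ 0 := by rw [← hs]; exact hs0.ne'
      have hq3 : (R ^ 2 - (Z.1 - X.1) ^ 2 - (Z.2 - X.2) ^ 2) ^ 3 ≠ 0 := by positivity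
      have hq4 : (R ^ 2 - (Z.1 - X.1) ^ 2 - (Z.2 - X.2) ^ 2) ^ 4 ≠ 0 := by positivity
      refine continuousAt_const.mul ((((((hca.pow 2).add (hcb.pow 2)).neg.div
        ((continuousAt_const.mul hcW).mul hsq) (mul_ne_zero (mul_ne_zero four_ne_zero hWZ.ne') hs3)).mul hHa).add
        (((hca.mul ((continuousAt_const.mul hx1).div (hqa.pow 3) hq3)).add
          (hcb.mul ((continuousAt_const.mul hx2).div (hqa.pow 3) hq3))).div hsq hs3)).add
          (hsq.mul (((continuousAt_const.div (hqa.pow 3) hq3).add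
            ((continuousAt_const.mul ((hx1.pow 2).add (hx2.pow 2))).div (hqa.pow 4) hq4)).sub 
            (continuousAt_const.mul ((continuousAt_const.mul hx1).div (hqa.pow 3) hq3))))))
    (by
      filter_upwards [hOo.mem_nhds hZin] with p hp
      have h1 := hZmax (hOK hp)
      simp only [mem_ofPred_eq, Pi.sub_apply] at h1
      have h2 : a Z / G * a Z + b Z / G * b Z = G := by
        field_simp; linarith
      have h3 : a Z / G * a p + b Z / G * b p ≤ √(a p ^ 2 + b p ^ 2) := by
        apply Real.le_sqrt_of_sq_le
        have : (a Z / G * a p + b Z / G * b p) ^ 2 = (a Z * a p + b Z * b p) ^ 2 / G ^ 2 := by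
          field_simp
        rw [this, div_le_iff₀ (by positivity), hG2]
        have h4 := sq_nonneg (a Z * b p - b Z * a p)
        have h5 : (a p ^ 2 + b p ^ 2) * (a Z ^ 2 + b Z ^ 2) = (a Z * a p + b Z * b p) ^ 2 + (a Z * b p - b Z * a p) ^ 2 := by ring
        linarith
      rw [h2]; rw [← hG] at h1; linarith)
  -- final
  obtain ⟨D, hD⟩ : ∃ D, D = R ^ 2 - (Z.1 - X.1) ^ 2 - (Z.2 - X.2) ^ 2 := ⟨_, rfl⟩
  have hHb : Hb R X Z = (R / D) ^ 2 := by unfold Hb; rw [← hD]; ring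
  rw [← hD] at hL hQ
  have hD2 : D = R ^ 2 - q Z := by rw [hD, hden]
  have hDR : D ≤ R ^ 2 := by linarith [hq0 Z]
  have hk : 0 < R / D := by positivity
  obtain ⟨k, hkd⟩ : ∃ k, k = R / D := ⟨_, rfl⟩
  rw [← hkd] at hHb hk
  have hqR : q Z ≤ R ^ 2 := by linarith
  have hx1 : |Z.1 - X.1| ≤ R := abs_le_of_sq_le_sq (by simp only [hq] at hqR; linarith [sq_nonneg (Z.2 - X.2)]) hR0.le
  have hk3 : 4 * k ^ 3 = 4 * R ^ 2 * R / D ^ 3 := by rw [hkd]; ring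
  have hk4 : 32 * k ^ 4 = 32 * R ^ 4 / D ^ 4 := by rw [hkd]; ring
  have hfin := final_ineq (γ := γ) (η := η) (k := k) (s := s) (g := G / s ^ 2) (A := A) (R := R)
    (T := 8 * R ^ 2 / D ^ 3 + 24 * R ^ 2 * q Z / D ^ 4) (Hx := 4 * R ^ 2 * (Z.1 - X.1) / D ^ 3)
    hγ hη hk hs0 hs1 hA hRη (by
      have : G / s ^ 2 * s ^ 2 = G := by field_simp
      rw [this, ← hHb, ← hψZ]; linarith) (by rw [← hHb]; exact hHZ)
    (by
      rw [hk4]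
      have e : 8 * R ^ 2 / D ^ 3 + 24 * R ^ 2 * q Z / D ^ 4 = (8 * R ^ 2 * D + 24 * R ^ 2 * q Z) / D ^ 4 := by
        field_simp
      rw [e]
      gcongr
      have : R ^ 2 * D ≤ R ^ 2 * R ^ 2 := by gcongr
      have : R ^ 2 * q Z ≤ R ^ 2 * R ^ 2 := by gcongr
      have : R ^ 4 = R ^ 2 * R ^ 2 := by ring
      linarith)
    (by
      rw [hk3, abs_div, abs_mul, abs_of_pos (show 0 < 4 * R ^ 2 by positivity), 
        abs_of_pos (show 0 < D ^ 3 by positivity)]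
      gcongr)
  -- inner product bound
  have hinner : a Z * (4 * R ^ 2 * (Z.1 - X.1) / D ^ 3) + b Z * (4 * R ^ 2 * (Z.2 - X.2) / D ^ 3) ≤ G * (4 * k ^ 3) := by
    rw [hk3]
    have h1 : a Z * (Z.1 - X.1) + b Z * (Z.2 - X.2) ≤ G * R := by
      refine abs_le_of_sq_le_sq ?_ (by positivity) |> (le_abs_self _).trans
      have h2 : (G * R) ^ 2 = (a Z ^ 2 + b Z ^ 2) * R ^ 2 := by rw [mul_pow, hG2]
      rw [h2]
      calc (a Z * (Z.1 - X.1) + b Z * (Z.2 - X.2)) ^ 2 ≤ (a Z ^ 2 + b Z ^ 2) * q Z := by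
            have h4 := sq_nonneg (a Z * (Z.2 - X.2) - b Z * (Z.1 - X.1))
            have h5 : (a Z ^ 2 + b Z ^ 2) * q Z = (a Z * (Z.1 - X.1) + b Z * (Z.2 - X.2)) ^ 2 + (a Z * (Z.2 - X.2) - b Z * (Z.1 - X.1)) ^ 2 := by
              simp only [hq]; ring
            linarith
        _ ≤ _ := by gcongr
    calc a Z * (4 * R ^ 2 * (Z.1 - X.1) / D ^ 3) + b Z * (4 * R ^ 2 * (Z.2 - X.2) / D ^ 3) 
        = 4 * R ^ 2 / D ^ 3 * (a Z * (Z.1 - X.1) + b Z * (Z.2 - X.2)) := by ring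
      _ ≤ 4 * R ^ 2 / D ^ 3 * (G * R) := by gcongr
      _ = _ := by ring
  rw [← hs, hsW, hHb, ← hG2] at hL
  have hL' := nonneg_of_mul_nonneg_right hL hA0
  have e1 : -G ^ 2 / (4 * s ^ 2 * s) * k ^ 2 = s * (-(k ^ 2 * (G / s ^ 2) ^ 2 / 4)) := by
    field_simp
  have e2 : (a Z * (4 * R ^ 2 * (Z.1 - X.1) / D ^ 3) + b Z * (4 * R ^ 2 * (Z.2 - X.2) / D ^ 3)) / s
      ≤ s * (G / s ^ 2 * (4 * k ^ 3)) := by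
    have : s * (G / s ^ 2 * (4 * k ^ 3)) = (G * (4 * k ^ 3)) / s := by field_simp
    rw [this]; gcongr
  rw [e1] at hL'
  have : 0 ≤ s * (-(k ^ 2 * (G / s ^ 2) ^ 2 / 4) + G / s ^ 2 * (4 * k ^ 3) + (8 * R ^ 2 / D ^ 3 + 24 * R ^ 2 * q Z / D ^ 4)
    - γ * (4 * R ^ 2 * (Z.1 - X.1) / D ^ 3)) := by
    simp only [hq]; linarith
  have := mul_neg_of_pos_of_neg hs0 hfin
  linarith

end Pkg


lemma clamp_ext {f : ℝ → ℝ → ℝ} {s1 s2 y1 y2 : ℝ} (hs : s1 ≤ s2) (hy : y1 ≤ y2)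
    (hf : ContinuousOn (Function.uncurry f) (Icc s1 s2 ×ˢ Icc y1 y2)) :
    ∃ F : ℝ → ℝ → ℝ, Continuous (Function.uncurry F) ∧
      ∀ s ∈ Icc s1 s2, ∀ y ∈ Icc y1 y2, F s y = f s y := by
  refine ⟨fun s y => f (max s1 (min s s2)) (max y1 (min y y2)), ?_, ?_⟩
  · have : Function.uncurry (fun s y => f (max s1 (min s s2)) (max y1 (min y y2))) =
      Function.uncurry f ∘ fun p : ℝ × ℝ => (max s1 (min p.1 s2), max y1 (min p.2 y2)) := by
      ext ⟨x, y⟩; rfl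
    rw [this]
    refine hf.comp_continuous (by fun_prop) fun p => ?_
    exact ⟨⟨le_max_left _ _, max_le hs (min_le_right _ _)⟩,
      ⟨le_max_left _ _, max_le hy (min_le_right _ _)⟩⟩
  · rintro s ⟨h1, h2⟩ y ⟨h3, h4⟩
    simp only
    rw [min_eq_left h2, min_eq_left h4, max_eq_right h1, max_eq_right h3]

lemma rect_swap {f : ℝ → ℝ → ℝ} {s1 s2 y1 y2 : ℝ} (hs : s1 ≤ s2) (hy : y1 ≤ y2)
    (hf : ContinuousOn (Function.uncurry f) (Icc s1 s2 ×ˢ Icc y1 y2)) :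
    ∫ y in y1..y2, ∫ s in s1..s2, f s y = ∫ s in s1..s2, ∫ y in y1..y2, f s y := by
  symm
  apply MeasureTheory.intervalIntegral_intervalIntegral_swap
  have h1 : MeasureTheory.IntegrableOn (Function.uncurry f) (Icc s1 s2 ×ˢ Icc y1 y2)
      MeasureTheory.volume :=
    hf.integrableOn_compact (isCompact_Icc.prod isCompact_Icc)
  refine h1.mono_set ?_
  rw [uIoc_of_le hs, uIoc_of_le hy]
  exact prod_mono Ioc_subset_Icc_self Ioc_subset_Icc_self

lemma rect_cont_s {f : ℝ → ℝ → ℝ} {s1 s2 y1 y2 : ℝ} (hs : s1 ≤ s2) (hy : y1 ≤ y2)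
    (hf : ContinuousOn (Function.uncurry f) (Icc s1 s2 ×ˢ Icc y1 y2)) :
    ContinuousOn (fun s => ∫ y in y1..y2, f s y) (Icc s1 s2) := by
  obtain ⟨F, hF, hFe⟩ := clamp_ext hs hy hf
  refine (intervalIntegral.continuous_parametric_intervalIntegral_of_continuous' 
    (μ := MeasureTheory.volume) hF y1 y2).continuousOn.congr fun s h => ?_
  refine intervalIntegral.integral_congr fun y hy' => ?_
  rw [uIcc_of_le hy] at hy'
  exact (hFe s h y hy').symm

lemma rect_cont_y {f : ℝ → ℝ → ℝ} {s1 s2 y1 y2 : ℝ} (hs : s1 ≤ s2) (hy : y1 ≤ y2)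
    (hf : ContinuousOn (Function.uncurry f) (Icc s1 s2 ×ˢ Icc y1 y2)) :
    ContinuousOn (fun y => ∫ s in s1..s2, f s y) (Icc y1 y2) := by
  have : ContinuousOn (Function.uncurry fun y s => f s y) (Icc y1 y2 ×ˢ Icc s1 s2) :=
    hf.comp (f := fun p : ℝ × ℝ => (p.2, p.1)) (by fun_prop) fun p hp => ⟨hp.2, hp.1⟩
  exact rect_cont_s hy hs this

lemma slice_s {f : ℝ → ℝ → ℝ} {S Y : Set ℝ} (hf : ContinuousOn (Function.uncurry f) (S ×ˢ Y)) 
    {y : ℝ} (hy : y ∈ Y) : ContinuousOn (fun s => f s y) S :=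
  hf.comp (f := fun s : ℝ => (s, y)) (by fun_prop) fun _ h => ⟨h, hy⟩

lemma slice_y {f : ℝ → ℝ → ℝ} {S Y : Set ℝ} (hf : ContinuousOn (Function.uncurry f) (S ×ˢ Y)) 
    {s : ℝ} (hs : s ∈ S) : ContinuousOn (fun y => f s y) Y :=
  hf.comp (f := fun y : ℝ => (s, y)) (by fun_prop) fun _ h => ⟨hs, h⟩

lemma ii_of_cont {f : ℝ → ℝ} {a b : ℝ} (h : a ≤ b) (hf : ContinuousOn f (Icc a b)) :
    IntervalIntegrable f MeasureTheory.volume a b := by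
  apply ContinuousOn.intervalIntegrable
  rwa [uIcc_of_le h]

lemma green {Pf Q r : ℝ → ℝ → ℝ} {L y1 y2 : ℝ} (hL : 0 ≤ L) (hy : y1 ≤ y2)
    (hP : ContinuousOn (Function.uncurry Pf) (Icc 0 L ×ˢ Icc y1 y2))
    (hQ : ContinuousOn (Function.uncurry Q) (Icc 0 L ×ˢ Icc y1 y2))
    (hr : ContinuousOn (Function.uncurry r) (Ioc 0 L ×ˢ Icc y1 y2))
    (hPd : ∀ s ∈ Ioc 0 L, ∀ y ∈ Icc y1 y2, HasDerivAt (fun s => Pf s y) (r s y) s)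
    (hQd : ∀ s ∈ Ioc 0 L, ∀ y ∈ Icc y1 y2, HasDerivAt (fun y => Q s y) (r s y) y) :
    ∫ y in y1..y2, (Pf L y - Pf 0 y) = ∫ s in (0:ℝ)..L, (Q s y2 - Q s y1) := by
  rcases hL.eq_or_lt with rfl | hL0
  · simp
  set G : ℝ → ℝ := fun s => ∫ y in y1..y2, (Pf L y - Pf s y) with hG
  set K : ℝ → ℝ := fun s => ∫ t in s..L, (Q t y2 - Q t y1) with hK
  have hGc : ContinuousOn G (Icc 0 L) := by
    refine rect_cont_s (f := fun s y => Pf L y - Pf s y) hL hy ?_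
    refine ContinuousOn.sub ?_ hP
    exact (slice_y hP ⟨hL, le_rfl⟩).comp continuousOn_snd fun p hp => hp.2
  have hQc : ContinuousOn (fun t => Q t y2 - Q t y1) (Icc 0 L) :=
    (slice_s hQ ⟨hy, le_rfl⟩).sub (slice_s hQ ⟨le_rfl, hy⟩)
  have hKc : ContinuousOn K (Icc 0 L) := by
    have h1 := intervalIntegral.continuousOn_primitive_interval (μ := MeasureTheory.volume)
      (f := fun t => Q t y2 - Q t y1) (a := L) (b := 0) (by
        rw [uIcc_comm, uIcc_of_le hL]
        exact hQc.integrableOn_compact isCompact_Icc)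
    rw [uIcc_comm, uIcc_of_le hL] at h1
    refine h1.neg.congr fun s _ => ?_
    simp only [hK]
    rw [intervalIntegral.integral_symm]
    rfl
  have heq : ∀ s ∈ Ioc 0 L, G s = K s := by
    intro s hs
    have hsub : Icc s L ×ˢ Icc y1 y2 ⊆ Ioc 0 L ×ˢ Icc y1 y2 :=
      prod_mono (fun t ht => ⟨lt_of_lt_of_le hs.1 ht.1, ht.2⟩) le_rfl
    have hr' := hr.mono hsub
    have h1 := rect_swap hs.2 hy hr'
    have h2 : G s = ∫ y in y1..y2, ∫ t in s..L, r t y := by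
      refine intervalIntegral.integral_congr fun y hy' => ?_
      rw [uIcc_of_le hy] at hy'
      have hI : IntervalIntegrable (fun t => r t y) MeasureTheory.volume s L :=
        ii_of_cont hs.2 (slice_s hr' hy')
      refine (intervalIntegral.integral_eq_sub_of_hasDerivAt (f := fun t => Pf t y) (fun t ht => ?_) hI).symm
      rw [uIcc_of_le hs.2] at ht
      exact hPd t ⟨lt_of_lt_of_le hs.1 ht.1, ht.2⟩ y hy'
    have h3 : K s = ∫ t in s..L, ∫ y in y1..y2, r t y := by
      refine intervalIntegral.integral_congr fun t ht => ?_
      rw [uIcc_of_le hs.2] at ht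
      have hI : IntervalIntegrable (fun y => r t y) MeasureTheory.volume y1 y2 :=
        ii_of_cont hy (slice_y hr' ht)
      refine (intervalIntegral.integral_eq_sub_of_hasDerivAt (f := fun y => Q t y) (fun y hy' => ?_) hI).symm
      rw [uIcc_of_le hy] at hy'
      exact hQd t ⟨lt_of_lt_of_le hs.1 ht.1, ht.2⟩ y hy'
    rw [h2, h3, h1]
  have hcl : closure (Ioc 0 L) = Icc 0 L := closure_Ioc hL0.ne
  have h4 : EqOn G K (closure (Ioc 0 L)) := by
    refine EqOn.of_subset_closure heq (s := Ioc 0 L) (t := closure (Ioc 0 L)) ?_ ?_ subset_closure le_rfl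
    · rw [hcl]; exact hGc
    · rw [hcl]; exact hKc
  exact h4 (by rw [hcl]; exact ⟨le_rfl, hL⟩)

/-- nonpositive primitives give nonpositive value at the start -/
lemma start_nonpos {l : ℝ → ℝ} (hl : ContinuousOn l (Icc 0 1))
    (h : ∀ s ∈ Ioc (0:ℝ) 1, ∫ t in (0:ℝ)..s, l t ≤ 0) : l 0 ≤ 0 := by
  by_contra! hpos
  have h1 : ContinuousWithinAt l (Icc 0 1) 0 := hl 0 ⟨le_rfl, zero_le_one⟩
  have h2 := h1.eventually (lt_mem_nhds hpos)
  rw [eventually_nhdsWithin_iff, Metric.eventually_nhds_iff] at h2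
  obtain ⟨ε, hε, h2⟩ := h2
  set s := min (ε / 2) 1
  have hs : 0 < s := by positivity
  have hs1 : s ≤ 1 := min_le_right _ _
  have hse : s ≤ ε / 2 := min_le_left _ _
  have h3 := intervalIntegral.intervalIntegral_pos_of_pos_on (f := l) (a := 0) (b := s)
    (ii_of_cont hs.le (hl.mono (Icc_subset_Icc le_rfl hs1))) (fun t ht => 
      h2 (by rw [Real.dist_eq, sub_zero, abs_of_pos ht.1]; linarith [ht.2])
        ⟨ht.1.le, ht.2.le.trans hs1⟩) hs
  linarith [h s ⟨hs, hs1⟩]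

lemma zero_of_int_zero {f : ℝ → ℝ} (hf : ContinuousOn f (Iio 0))
    (h : ∀ y1 y2, y1 ≤ y2 → y2 < 0 → ∫ y in y1..y2, f y = 0) {y : ℝ} (hy : y < 0) : f y = 0 := by
  have h1 : HasDerivAt (fun t => ∫ x in (y - 1)..t, f x) (f y) y := by
    apply intervalIntegral.integral_hasDerivAt_right
    · exact ii_of_cont (by linarith) (hf.mono fun t ht => lt_of_le_of_lt ht.2 hy)
    · exact hf.stronglyMeasurableAtFilter isOpen_Iio y hy
    · exact hf.continuousAt (Iio_mem_nhds hy)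
  have h2 : (fun t => ∫ x in (y - 1)..t, f x) =ᶠ[𝓝 y] fun _ => 0 := by
    filter_upwards [Ioo_mem_nhds (show y - 1 < y by linarith) hy] with t ht
    exact h _ _ ht.1.le ht.2
  have h3 := h2.deriv_eq
  rw [h1.deriv] at h3
  simpa using h3


namespace Pkg
variable {γ M lam : ℝ} {W a b : ℝ × ℝ → ℝ} {φ φ' : ℝ → ℝ}

/-- straightened function -/
def st (f : ℝ × ℝ → ℝ) (φ : ℝ → ℝ) (s y : ℝ) : ℝ := f (φ y - s, y)

lemma st_cont (P : Pkg γ M lam W a b φ φ') {f : ℝ × ℝ → ℝ} (hf : ContinuousOn f (Cl φ)) :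
    ContinuousOn (Function.uncurry (st f φ)) (Ici 0 ×ˢ Iio 0) := by
  refine hf.comp (f := fun p : ℝ × ℝ => (φ p.2 - p.1, p.2)) ?_ fun p hp => ⟨hp.2, ?_⟩
  · exact ((P.φc.comp continuousOn_snd fun p hp => hp.2).sub continuousOn_fst).prodMk continuousOn_snd
  · have : 0 ≤ p.1 := hp.1
    simpa using this

lemma st_contO (P : Pkg γ M lam W a b φ φ') {f : ℝ × ℝ → ℝ} (hf : ContinuousOn f (Om φ)) :
    ContinuousOn (Function.uncurry (st f φ)) (Ioi 0 ×ˢ Iio 0) := by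
  refine hf.comp (f := fun p : ℝ × ℝ => (φ p.2 - p.1, p.2)) ?_ fun p hp => ⟨hp.2, ?_⟩
  · exact ((P.φc.comp continuousOn_snd fun p hp => hp.2).sub continuousOn_fst).prodMk continuousOn_snd
  · have : 0 < p.1 := hp.1
    simpa using this

lemma mem_Om {s y : ℝ} (hs : 0 < s) (hy : y < 0) : (φ y - s, y) ∈ Om φ := ⟨hy, by simpa using hs⟩
lemma mem_Cl {s y : ℝ} (hs : 0 ≤ s) (hy : y < 0) : (φ y - s, y) ∈ Cl φ := ⟨hy, by simpa using hs⟩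

lemma st_ds {f : ℝ × ℝ → ℝ} {f' : ℝ × ℝ →L[ℝ] ℝ} {s y : ℝ}
    (hf : HasFDerivAt f f' (φ y - s, y)) : HasDerivAt (fun s => st f φ s y) (- f' (1, 0)) s := by
  have hl : HasDerivAt (fun s : ℝ => (φ y - s, y)) ((-1 : ℝ), (0 : ℝ)) s :=
    ((hasDerivAt_id s).const_sub (φ y)).prodMk (hasDerivAt_const s y)
  have := hf.comp_hasDerivAt s hl
  refine this.congr_deriv ?_
  rw [← map_neg]; congr 1; simp

lemma st_dy (P : Pkg γ M lam W a b φ φ') {f : ℝ × ℝ → ℝ} {f' : ℝ × ℝ →L[ℝ] ℝ} {s y : ℝ} (hy : y < 0)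
    (hf : HasFDerivAt f f' (φ y - s, y)) :
    HasDerivAt (fun y => st f φ s y) (φ' y * f' (1, 0) + f' (0, 1)) y := by
  have hl : HasDerivAt (fun y : ℝ => (φ y - s, y)) (φ' y, (1 : ℝ)) y :=
    ((P.dφ y hy).sub_const s).prodMk (hasDerivAt_id y)
  have := HasFDerivAt.comp_hasDerivAt (f := fun y : ℝ => (φ y - s, y)) y hf hl
  refine this.congr_deriv ?_
  have e : ((φ' y, (1:ℝ)) : ℝ × ℝ) = φ' y • (1, 0) + (0, 1) := by simp
  rw [e, map_add, map_smul, smul_eq_mul]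

lemma dWs (P : Pkg γ M lam W a b φ φ') {s y : ℝ} (hs : 0 < s) (hy : y < 0) :
    HasDerivAt (fun s => st W φ s y) (- st a φ s y) s :=
  (st_ds (P.hW _ (mem_Om hs hy))).congr_deriv (by simp [st])

lemma dWy (P : Pkg γ M lam W a b φ φ') {s y : ℝ} (hs : 0 < s) (hy : y < 0) :
    HasDerivAt (fun y => st W φ s y) (φ' y * st a φ s y + st b φ s y) y :=
  (P.st_dy hy (P.hW _ (mem_Om hs hy))).congr_deriv (by simp [st])

lemma φ'c' (P : Pkg γ M lam W a b φ φ') : ContinuousOn φ' (Iio 0) := P.φ'c.continuousOn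

/-- flux -/
def Zf (γ : ℝ) (W a b : ℝ × ℝ → ℝ) (φ φ' : ℝ → ℝ) (s y : ℝ) : ℝ :=
  st a φ s y - φ' y * st b φ s y - γ * st W φ s y

lemma φ'cc (P : Pkg γ M lam W a b φ φ') (S : Set ℝ) : 
    ContinuousOn (fun p : ℝ × ℝ => φ' p.2) (S ×ˢ Iio 0) :=
  P.φ'c'.comp continuousOn_snd fun p hp => hp.2

lemma Zf_cont (P : Pkg γ M lam W a b φ φ') :
    ContinuousOn (Function.uncurry (Zf γ W a b φ φ')) (Ici 0 ×ˢ Iio 0) :=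
  ((P.st_cont P.ac).sub ((P.φ'cc _).mul (P.st_cont P.bc))).sub 
    (continuousOn_const.mul (P.st_cont P.Wc))

lemma sub1 {L y1 y2 : ℝ} (hy2 : y2 < 0) : Icc 0 L ×ˢ Icc y1 y2 ⊆ (Ici 0 ×ˢ Iio 0 : Set (ℝ × ℝ)) :=
  prod_mono (fun _ h => h.1) (fun _ h => lt_of_le_of_lt h.2 hy2)

lemma sub2 {L y1 y2 : ℝ} (hy2 : y2 < 0) : Ioc 0 L ×ˢ Icc y1 y2 ⊆ (Ioi 0 ×ˢ Iio 0 : Set (ℝ × ℝ)) :=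
  prod_mono (fun _ h => h.1) (fun _ h => lt_of_le_of_lt h.2 hy2)

lemma greenF (P : Pkg γ M lam W a b φ φ') {L y1 y2 : ℝ} (hL : 0 ≤ L) (hy : y1 ≤ y2) (hy2 : y2 < 0) :
    ∫ y in y1..y2, (Zf γ W a b φ φ' L y - Zf γ W a b φ φ' 0 y) =
      ∫ s in (0:ℝ)..L, (st b φ s y2 - st b φ s y1) := by
  refine green (r := fun s y => φ' y * fderiv ℝ b (φ y - s, y) (1, 0) + fderiv ℝ b (φ y - s, y) (0, 1))
    hL hy (P.Zf_cont.mono (sub1 hy2)) ((P.st_cont P.bc).mono (sub1 hy2)) ?_ ?_ ?_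
  · have hb := P.bC.continuousOn_fderiv_of_isOpen P.openOm le_rfl
    have hb1 : ContinuousOn (fun p => fderiv ℝ b p (1, 0)) (Om φ) := hb.clm_apply continuousOn_const
    have hb2 : ContinuousOn (fun p => fderiv ℝ b p (0, 1)) (Om φ) := hb.clm_apply continuousOn_const
    exact (((P.φ'cc _).mul (P.st_contO hb1)).add (P.st_contO hb2)).mono (sub2 hy2)
  · intro s hs y hy'
    have hy0 : y < 0 := lt_of_le_of_lt hy'.2 hy2
    have hm : (φ y - s, y) ∈ Om φ := mem_Om hs.1 hy0
    have h1 := st_ds (P.adiff hm).hasFDerivAt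
    have h2 := st_ds (P.bdiff hm).hasFDerivAt
    have h3 := P.dWs hs.1 hy0
    have h4 := P.pde _ hm
    refine ((h1.sub (h2.const_mul (φ' y))).sub (h3.const_mul γ)).congr_deriv ?_
    simp only [st]
    linarith
  · intro s hs y hy'
    have hy0 : y < 0 := lt_of_le_of_lt hy'.2 hy2
    exact P.st_dy hy0 (P.bdiff (mem_Om hs.1 hy0)).hasFDerivAt

lemma Wt0 (P : Pkg γ M lam W a b φ φ') {y : ℝ} (hy : y < 0) : st W φ 0 y = 1 := by
  simp [st, P.Wbd y hy]

lemma dWy_int (P : Pkg γ M lam W a b φ φ') {s y1 y2 : ℝ} (hs : 0 < s) (hy : y1 ≤ y2) (hy2 : y2 < 0) :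
    ∫ y in y1..y2, (φ' y * st a φ s y + st b φ s y) = st W φ s y2 - st W φ s y1 := by
  refine intervalIntegral.integral_eq_sub_of_hasDerivAt (f := fun y => st W φ s y) (fun y hy' => ?_) ?_
  · rw [uIcc_of_le hy] at hy'
    exact P.dWy hs (lt_of_le_of_lt hy'.2 hy2)
  · refine ii_of_cont hy ?_
    have hc : ContinuousOn (Function.uncurry fun s y => φ' y * st a φ s y + st b φ s y) (Ici 0 ×ˢ Iio 0) :=
      ((P.φ'cc _).mul (P.st_cont P.ac)).add (P.st_cont P.bc)
    exact (slice_y hc hs.le).mono fun y h => lt_of_le_of_lt h.2 hy2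

lemma tang (P : Pkg γ M lam W a b φ φ') {y : ℝ} (hy : y < 0) :
    φ' y * a (φ y, y) + b (φ y, y) = 0 := by
  have hc : ContinuousOn (Function.uncurry fun s y => φ' y * st a φ s y + st b φ s y) (Ici 0 ×ˢ Iio 0) :=
    ((P.φ'cc _).mul (P.st_cont P.ac)).add (P.st_cont P.bc)
  have hc0 := slice_y hc (s := 0) (mem_Ici.2 le_rfl)
  have := zero_of_int_zero (f := fun y => φ' y * st a φ 0 y + st b φ 0 y) hc0 ?_ hy
  · simpa [st] using this
  intro y1 y2 h1 h2
  have hF : ContinuousOn (fun s => ∫ y in y1..y2, (φ' y * st a φ s y + st b φ s y)) (Icc 0 1) :=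
    rect_cont_s zero_le_one h1 (hc.mono (sub1 h2))
  have hG : ContinuousOn (fun s => st W φ s y2 - st W φ s y1) (Icc 0 1) :=
    ((slice_s (P.st_cont P.Wc) h2).sub (slice_s (P.st_cont P.Wc) (lt_of_le_of_lt h1 h2))).mono
      fun s h => h.1
  have hcl : closure (Ioc (0:ℝ) 1) = Icc 0 1 := closure_Ioc zero_ne_one
  have h4 : EqOn (fun s => ∫ y in y1..y2, (φ' y * st a φ s y + st b φ s y))
      (fun s => st W φ s y2 - st W φ s y1) (closure (Ioc 0 1)) := by
    refine EqOn.of_subset_closure (s := Ioc 0 1) (t := closure (Ioc 0 1)) 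
      (fun s hs => P.dWy_int hs.1 h1 h2) ?_ ?_ subset_closure le_rfl
    · rw [hcl]; exact hF
    · rw [hcl]; exact hG
  have h5 := h4 (x := 0) (by rw [hcl]; exact ⟨le_rfl, zero_le_one⟩)
  simp only at h5
  rw [h5, P.Wt0 h2, P.Wt0 (lt_of_le_of_lt h1 h2), sub_self]

lemma a0 (P : Pkg γ M lam W a b φ φ') {y : ℝ} (hy : y < 0) : 0 ≤ a (φ y, y) := by
  have hc := (slice_s (P.st_cont P.ac) hy)
  have h1 : Tendsto (fun s => st a φ s y) (𝓝[>] 0) (𝓝 (st a φ 0 y)) :=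
    (hc 0 (mem_Ici.2 le_rfl)).mono Ioi_subset_Ici_self
  have h2 : 0 ≤ st a φ 0 y := by
    refine ge_of_tendsto h1 ?_
    filter_upwards [self_mem_nhdsWithin] with s hs
    exact (P.apos _ (mem_Om hs hy)).le
  simpa [st] using h2

lemma gradbd (P : Pkg γ M lam W a b φ φ') {y : ℝ} (hy : y < 0) :
    a (φ y, y) = Real.cos (Real.arctan (- φ' y)) ∧ b (φ y, y) = Real.sin (Real.arctan (- φ' y)) := by
  have h1 := P.tang hy
  have h2 := P.a0 hy
  have h3 := P.gbd y hy
  rw [Real.cos_arctan, Real.sin_arctan]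
  have hb : b (φ y, y) = - φ' y * a (φ y, y) := by linarith
  rw [hb] at h3
  have hp : 0 < 1 + (- φ' y) ^ 2 := by positivity
  have ha : a (φ y, y) = 1 / √(1 + (- φ' y) ^ 2) := by
    have h4 : a (φ y, y) ^ 2 = 1 / (1 + (- φ' y) ^ 2) := by
      field_simp; linarith
    rw [← Real.sqrt_sq h2, h4, Real.sqrt_div zero_le_one, Real.sqrt_one]
  refine ⟨ha, ?_⟩
  rw [hb, ha]; ring

lemma sec_eq (x : ℝ) : (Real.cos (Real.arctan x))⁻¹ = √(1 + x ^ 2) := by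
  rw [Real.cos_arctan]; simp

lemma Zf0 (P : Pkg γ M lam W a b φ φ') {y : ℝ} (hy : y < 0) :
    Zf γ W a b φ φ' 0 y = √(1 + φ' y ^ 2) - γ := by
  obtain ⟨h1, h2⟩ := P.gradbd hy
  have hp : 0 < 1 + φ' y ^ 2 := by positivity
  unfold Zf
  rw [P.Wt0 hy]
  simp only [st, sub_zero]
  rw [h1, h2, Real.cos_arctan, Real.sin_arctan, neg_sq]
  have hs : 0 < √(1 + φ' y ^ 2) := Real.sqrt_pos.2 hp
  have e : √(1 + φ' y ^ 2) ^ 2 = 1 + φ' y ^ 2 := Real.sq_sqrt hp.le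
  field_simp
  linear_combination (-1 : ℝ) * e

lemma ode_ineq (P : Pkg γ M lam W a b φ φ') {A Y0 : ℝ} (hA : 0 < A) (hY : 0 < Y0)
    (hkey : ∀ X ∈ Om φ, X.2 ≤ -Y0 →
      √(a X ^ 2 + b X ^ 2) ≤ W X + A * (√(W X) - W X) / X.2 ^ 2)
    {y1 y2 : ℝ} (hy : y1 ≤ y2) (hy2 : y2 ≤ -Y0) :
    Real.sin (Real.arctan (- φ' y2)) - Real.sin (Real.arctan (- φ' y1)) ≤
      ∫ y in y1..y2, (γ * Real.cos (Real.arctan (- φ' y)) - 1 + A / y ^ 2) := by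
  have hy20 : y2 < 0 := by linarith
  have hy10 : y1 < 0 := by linarith
  set κ : ℝ → ℝ := fun y => γ - √(1 + φ' y ^ 2) + A * √(1 + φ' y ^ 2) / y ^ 2 with hκ
  have hκc : ContinuousOn κ (Iio 0) := by
    have h1 : ContinuousOn (fun y => √(1 + φ' y ^ 2)) (Iio 0) :=
      (continuousOn_const.add (P.φ'c'.pow 2)).sqrt
    refine (continuousOn_const.sub h1).add ((continuousOn_const.mul h1).div (by fun_prop) fun y h => ?_)
    exact pow_ne_zero _ (ne_of_lt h)
  have hac : ContinuousOn (Function.uncurry fun s y => st a φ s y * κ y) (Ici 0 ×ˢ Iio 0) :=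
    (P.st_cont P.ac).mul (hκc.comp continuousOn_snd fun p hp => hp.2)
  set l : ℝ → ℝ := fun s => (st b φ s y2 - st b φ s y1) - ∫ y in y1..y2, st a φ s y * κ y with hl
  have hlc : ∀ L, 0 ≤ L → ContinuousOn l (Icc 0 L) := by
    intro L hL
    refine ContinuousOn.sub ?_ (rect_cont_s hL hy (hac.mono (sub1 hy20)))
    exact ((slice_s (P.st_cont P.bc) hy20).sub (slice_s (P.st_cont P.bc) hy10)).mono fun s h => h.1
  have h0 := start_nonpos (hlc 1 zero_le_one) ?_
  · simp only [hl, st, sub_zero] at h0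
    rw [(P.gradbd hy20).2, (P.gradbd hy10).2] at h0
    have e : ∫ y in y1..y2, a (φ y, y) * κ y = 
       ∫ y in y1..y2, (γ * Real.cos (Real.arctan (- φ' y)) - 1 + A / y ^ 2) := by
      refine intervalIntegral.integral_congr fun y hy' => ?_
      rw [uIcc_of_le hy] at hy'
      have hy0 : y < 0 := by linarith [hy'.2]
      simp only [hκ]
      rw [(P.gradbd hy0).1, Real.cos_arctan, neg_sq]
      have hs : 0 < √(1 + φ' y ^ 2) := Real.sqrt_pos.2 (by positivity)
      have := hy0.ne
      field_simp
    linarith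
  · intro s hs
    have hi1 : IntervalIntegrable (fun s => st b φ s y2 - st b φ s y1) MeasureTheory.volume 0 s :=
      ii_of_cont hs.1.le (((slice_s (P.st_cont P.bc) hy20).sub 
        (slice_s (P.st_cont P.bc) hy10)).mono fun s h => h.1)
    have hi2 : IntervalIntegrable (fun s => ∫ y in y1..y2, st a φ s y * κ y) MeasureTheory.volume 0 s :=
      ii_of_cont hs.1.le (rect_cont_s hs.1.le hy (hac.mono (sub1 hy20)))
    rw [hl, intervalIntegral.integral_sub hi1 hi2, ← P.greenF hs.1.le hy hy20,
      ← rect_swap hs.1.le hy (hac.mono (sub1 hy20)), sub_nonpos]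
    have hsl : ∀ t, 0 ≤ t → ContinuousOn (fun y => Zf γ W a b φ φ' t y) (Icc y1 y2) := fun t ht =>
      (slice_y P.Zf_cont (mem_Ici.2 ht)).mono fun y h => lt_of_le_of_lt h.2 hy20
    refine intervalIntegral.integral_mono_on hy ?_ ?_ ?_
    · exact ii_of_cont hy ((hsl s hs.1.le).sub (hsl 0 le_rfl))
    · exact ii_of_cont hy (rect_cont_y hs.1.le hy (hac.mono (sub1 hy20)))
    · intro y hy'
      have hy0 : y < 0 := by linarith [hy'.2]
      have e1 : ∫ t in (0:ℝ)..s, st a φ t y * κ y = (1 - st W φ s y) * κ y := by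
        rw [intervalIntegral.integral_mul_const]
        congr 1
        have := intervalIntegral.integral_eq_sub_of_hasDerivAt_of_le (f := fun t => - st W φ t y)
          (f' := fun t => st a φ t y) hs.1.le 
          (((slice_s (P.st_cont P.Wc) hy0).mono fun s h => h.1).neg)
          (fun t ht => ((P.dWs ht.1 hy0).neg).congr_deriv (by simp))
          (ii_of_cont hs.1.le ((slice_s (P.st_cont P.ac) hy0).mono fun s h => h.1))
        rw [this, P.Wt0 hy0]; ring
      rw [e1, P.Zf0 hy0]
      have hm : (φ y - s, y) ∈ Om φ := mem_Om hs.1 hy0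
      have hk := hkey _ hm (by simp; linarith [hy'.2])
      have hWp := P.Wpos _ (Om_sub φ hm)
      have hWl := P.Wle _ (Om_sub φ hm)
      unfold Zf
      simp only [st, hκ] 
      simp only at hk
      generalize a (φ y - s, y) = a1 at *
      generalize b (φ y - s, y) = b1 at *
      generalize W (φ y - s, y) = w at *
      have hS0 : 0 < √(1 + φ' y ^ 2) := Real.sqrt_pos.2 (by positivity)
      have h1 : a1 - φ' y * b1 ≤ √(1 + φ' y ^ 2) * √(a1 ^ 2 + b1 ^ 2) := by
        rw [← Real.sqrt_mul (by positivity)]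
        apply Real.le_sqrt_of_sq_le
        nlinarith [sq_nonneg (b1 + φ' y * a1)]
      generalize √(1 + φ' y ^ 2) = S at *
      have h2 : S * √(a1 ^ 2 + b1 ^ 2) ≤ S * (w + A * (1 - w) / y ^ 2) := by
        have h3 : √w ≤ 1 := Real.sqrt_le_one.2 hWl
        have h4 : A * (√w - w) / y ^ 2 ≤ A * (1 - w) / y ^ 2 := by gcongr
        gcongr
        linarith
      have h5 : S * (w + A * (1 - w) / y ^ 2) = S * w + (1 - w) * (A * S / y ^ 2) := by ring
      nlinarith

end Pkg


lemma exp_int {k q s0 L : ℝ} (hk : 0 < k) (hL : s0 ≤ L) :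
    ∫ s in s0..L, Real.exp (k * (q - s)) ≤ Real.exp (k * (q - s0)) / k := by
  have h : ∫ s in s0..L, Real.exp (k * (q - s)) = 
      (- Real.exp (k * (q - L)) / k) - (- Real.exp (k * (q - s0)) / k) := by
    refine intervalIntegral.integral_eq_sub_of_hasDerivAt (f := fun s => - Real.exp (k * (q - s)) / k)
      (fun s _ => ?_) ?_
    · have := ((((hasDerivAt_id s).const_sub q).const_mul k).exp.neg.div_const k)
      refine this.congr_deriv ?_
      simp only [id]
      field_simp
    · exact (by fun_prop : Continuous fun s => Real.exp (k * (q - s))).intervalIntegrable _ _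
  rw [h]
  have : 0 < Real.exp (k * (q - L)) / k := by positivity
  have e : - Real.exp (k * (q - L)) / k = - (Real.exp (k * (q - L)) / k) := by ring
  have e' : - Real.exp (k * (q - s0)) / k = - (Real.exp (k * (q - s0)) / k) := by ring
  rw [e, e']; linarith

namespace Pkg
variable {γ M lam : ℝ} {W a b : ℝ × ℝ → ℝ} {φ φ' : ℝ → ℝ}

lemma Wexp (P : Pkg γ M lam W a b φ φ') {s y : ℝ} (hs : 0 ≤ s) (hy : y < 0) :
    st W φ s y ≤ Real.exp (lam * (φ y - M - s)) := by
  rcases le_total s (φ y - M) with h | h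
  · refine (P.Wle _ (mem_Cl hs hy)).trans ?_
    rw [Real.one_le_exp_iff]
    exact mul_nonneg P.hlam.le (by linarith)
  · have := P.decay (φ y - s) (by linarith) y hy
    refine this.trans (le_of_eq ?_)
    congr 2; ring

lemma sqW (P : Pkg γ M lam W a b φ φ') {s y : ℝ} (hs : 0 ≤ s) (hy : y < 0) :
    √(st W φ s y) ≤ Real.exp (lam / 2 * (φ y - M - s)) := by
  refine (Real.sqrt_le_sqrt (P.Wexp hs hy)).trans (le_of_eq ?_)
  rw [← Real.exp_half]
  congr 1; ring

lemma WE (P : Pkg γ M lam W a b φ φ') {s y : ℝ} (hs : 0 ≤ s) (hy : y < 0) :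
    st W φ s y ≤ Real.exp (lam / 2 * (φ y - M - s)) := by
  refine le_trans ?_ (P.sqW hs hy)
  have h1 : 0 < st W φ s y := P.Wpos _ (mem_Cl hs hy)
  have h2 : st W φ s y ≤ 1 := P.Wle _ (mem_Cl hs hy)
  exact Real.le_sqrt_of_sq_le (by nlinarith)

lemma gE (P : Pkg γ M lam W a b φ φ') {A Y0 : ℝ} (hA : 0 < A) (hY : 0 < Y0)
    (hkey : ∀ X ∈ Om φ, X.2 ≤ -Y0 →
      √(a X ^ 2 + b X ^ 2) ≤ W X + A * (√(W X) - W X) / X.2 ^ 2) {s y : ℝ} (hs : 0 < s) (hy : y ≤ -Y0) :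
    |st a φ s y| ≤ (1 + A / Y0 ^ 2) * Real.exp (lam / 2 * (φ y - M - s)) ∧ 
    |st b φ s y| ≤ (1 + A / Y0 ^ 2) * Real.exp (lam / 2 * (φ y - M - s)) := by
  have hy0 : y < 0 := by linarith
  have hm : (φ y - s, y) ∈ Om φ := mem_Om hs hy0
  have hk := hkey _ hm hy
  have hE := P.sqW hs.le hy0
  have h1 : 0 < st W φ s y := P.Wpos _ (mem_Cl hs.le hy0)
  have h2 : st W φ s y ≤ 1 := P.Wle _ (mem_Cl hs.le hy0)
  have h3 : st W φ s y ≤ √(st W φ s y) := Real.le_sqrt_of_sq_le (by nlinarith)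
  change √(st a φ s y ^ 2 + st b φ s y ^ 2) ≤ st W φ s y + A * (√(st W φ s y) - st W φ s y) / y ^ 2 at hk
  have hC : 0 < 1 + A / Y0 ^ 2 := by positivity
  have h4 : √(st a φ s y ^ 2 + st b φ s y ^ 2) ≤ (1 + A / Y0 ^ 2) * Real.exp (lam / 2 * (φ y - M - s)) := by
    refine hk.trans (le_trans ?_ (mul_le_mul_of_nonneg_left hE hC.le))
    have h5 : A * (√(st W φ s y) - st W φ s y) / y ^ 2 ≤ A * (√(st W φ s y)) / Y0 ^ 2 := by
      have : Y0 ^ 2 ≤ y ^ 2 := by nlinarith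
      have h6 : √(st W φ s y) - st W φ s y ≤ √(st W φ s y) := by linarith
      have h7 : 0 ≤ √(st W φ s y) - st W φ s y := by linarith
      gcongr
    have e : (1 + A / Y0 ^ 2) * √(st W φ s y) = √(st W φ s y) + A * (√(st W φ s y)) / Y0 ^ 2 := by ring
    rw [e]; linarith
  constructor
  · refine le_trans ?_ h4
    rw [← Real.sqrt_sq_eq_abs]
    exact Real.sqrt_le_sqrt (by nlinarith [sq_nonneg (st b φ s y)])
  · refine le_trans ?_ h4
    rw [← Real.sqrt_sq_eq_abs]
    exact Real.sqrt_le_sqrt (by nlinarith [sq_nonneg (st a φ s y)])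

lemma Scont (P : Pkg γ M lam W a b φ φ') : ContinuousOn (fun y => √(1 + φ' y ^ 2) - γ) (Iio 0) :=
  (continuousOn_const.add (P.φ'c'.pow 2)).sqrt.sub continuousOn_const

lemma E3 (P : Pkg γ M lam W a b φ φ') {L y ya : ℝ} (hL : 0 ≤ L) (hy : y ≤ ya) (hya : ya < 0) :
    ∫ s in (0:ℝ)..L, st b φ s y = (∫ s in (0:ℝ)..L, st b φ s ya) + 
      (∫ t in y..ya, (√(1 + φ' t ^ 2) - γ)) - ∫ t in y..ya, Zf γ W a b φ φ' L t := by
  have h := P.greenF hL hy hya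
  have hi : ∀ y < 0, IntervalIntegrable (fun s => st b φ s y) MeasureTheory.volume 0 L := fun y hy =>
    ii_of_cont hL ((slice_s (P.st_cont P.bc) hy).mono fun s h => h.1)
  have hsl : ∀ t, 0 ≤ t → IntervalIntegrable (fun y => Zf γ W a b φ φ' t y) MeasureTheory.volume y ya := 
    fun t ht => ii_of_cont hy ((slice_y P.Zf_cont (mem_Ici.2 ht)).mono fun y h => lt_of_le_of_lt h.2 hya)
  rw [intervalIntegral.integral_sub (hi _ hya) (hi _ (lt_of_le_of_lt hy hya)), 
    intervalIntegral.integral_sub (hsl L hL) (hsl 0 le_rfl)] at h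
  have e : ∫ t in y..ya, Zf γ W a b φ φ' 0 t = ∫ t in y..ya, (√(1 + φ' t ^ 2) - γ) := by
    refine intervalIntegral.integral_congr fun t ht => ?_
    rw [uIcc_of_le hy] at ht
    exact P.Zf0 (lt_of_le_of_lt ht.2 hya)
  rw [e] at h
  linarith

lemma ia (P : Pkg γ M lam W a b φ φ') {s y : ℝ} (hs : 0 ≤ s) (hy0 : y < 0) :
    ∫ t in (0:ℝ)..s, st a φ t y = 1 - st W φ s y := by
  have := intervalIntegral.integral_eq_sub_of_hasDerivAt_of_le (f := fun t => - st W φ t y)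
    (f' := fun t => st a φ t y) hs
    (((slice_s (P.st_cont P.Wc) hy0).mono fun s h => h.1).neg)
    (fun t ht => ((P.dWs ht.1 hy0).neg).congr_deriv (by simp))
    (ii_of_cont hs ((slice_s (P.st_cont P.ac) hy0).mono fun s h => h.1))
  rw [this, P.Wt0 hy0]; ring

lemma Jcont (P : Pkg γ M lam W a b φ φ') {L y1 y2 : ℝ} (hL : 0 ≤ L) (hy : y1 ≤ y2) (hy2 : y2 < 0) :
    ContinuousOn (fun y => ∫ s in (0:ℝ)..L, st b φ s y) (Icc y1 y2) :=
  rect_cont_y hL hy ((P.st_cont P.bc).mono (sub1 hy2))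

lemma E4 (P : Pkg γ M lam W a b φ φ') {L yb ya : ℝ} (hL : 0 ≤ L) (hy : yb ≤ ya) (hya : ya < 0) :
    (∫ s in (0:ℝ)..L, st W φ s ya) - (∫ s in (0:ℝ)..L, st W φ s yb) = 
      ∫ y in yb..ya, (φ' y * (1 - st W φ L y) + ∫ s in (0:ℝ)..L, st b φ s y) := by
  have hi : ∀ y < 0, IntervalIntegrable (fun s => st W φ s y) MeasureTheory.volume 0 L := fun y hy =>
    ii_of_cont hL ((slice_s (P.st_cont P.Wc) hy).mono fun s h => h.1)
  have hc : ContinuousOn (Function.uncurry fun s y => φ' y * st a φ s y + st b φ s y) (Ici 0 ×ˢ Iio 0) :=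
    ((P.φ'cc _).mul (P.st_cont P.ac)).add (P.st_cont P.bc)
  have h := rect_swap hL hy (hc.mono (sub1 hya))
  rw [← intervalIntegral.integral_sub (hi _ hya) (hi _ (lt_of_le_of_lt hy hya))]
  have e1 : ∫ s in (0:ℝ)..L, ∫ y in yb..ya, (φ' y * st a φ s y + st b φ s y) =
      ∫ s in (0:ℝ)..L, (st W φ s ya - st W φ s yb) := by
    refine intervalIntegral.integral_congr_uIoo fun s hs => ?_
    rw [uIoo_of_le hL] at hs
    exact P.dWy_int hs.1 hy hya
  rw [← e1, ← h]
  refine intervalIntegral.integral_congr fun y hy' => ?_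
  rw [uIcc_of_le hy] at hy'
  have hy0 := lt_of_le_of_lt hy'.2 hya
  have ja : IntervalIntegrable (fun s => st a φ s y) MeasureTheory.volume 0 L := 
    ii_of_cont hL ((slice_s (P.st_cont P.ac) hy0).mono fun s h => h.1)
  have jb : IntervalIntegrable (fun s => st b φ s y) MeasureTheory.volume 0 L := 
    ii_of_cont hL ((slice_s (P.st_cont P.bc) hy0).mono fun s h => h.1)
  rw [intervalIntegral.integral_add (ja.const_mul _) jb, intervalIntegral.integral_const_mul, P.ia hL hy0]

lemma Ibound (P : Pkg γ M lam W a b φ φ') {L y : ℝ} (hy : y < 0) (hL : φ y - M ≤ L) :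
    ∫ s in (0:ℝ)..L, st W φ s y ≤ φ y - M + 1 / lam := by
  have h0 : 0 ≤ φ y - M := by linarith [P.Mφ y hy]
  have hi : ∀ s t, 0 ≤ s → s ≤ t → IntervalIntegrable (fun s => st W φ s y) MeasureTheory.volume s t := 
    fun s t hs hst => ii_of_cont hst ((slice_s (P.st_cont P.Wc) hy).mono fun r h => hs.trans h.1)
  rw [← intervalIntegral.integral_add_adjacent_intervals (hi 0 (φ y - M) le_rfl h0) (hi _ L h0 hL)]
  refine add_le_add ?_ ?_
  · have := intervalIntegral.integral_mono_on h0 (hi 0 _ le_rfl h0) (intervalIntegrable_const (c := (1:ℝ)))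
      fun s hs => P.Wle _ (mem_Cl hs.1 hy)
    simpa using this
  · have h2 := exp_int (q := φ y - M) P.hlam hL
    have := intervalIntegral.integral_mono_on hL (hi _ L h0 hL) 
      ((by fun_prop : Continuous fun s => Real.exp (lam * (φ y - M - s))).intervalIntegrable _ _)
      fun s hs => P.Wexp (h0.trans hs.1) hy
    refine this.trans (h2.trans ?_)
    simp

lemma Jbound (P : Pkg γ M lam W a b φ φ') {A Y0 : ℝ} (hA : 0 < A) (hY : 0 < Y0)
    (hkey : ∀ X ∈ Om φ, X.2 ≤ -Y0 →
      √(a X ^ 2 + b X ^ 2) ≤ W X + A * (√(W X) - W X) / X.2 ^ 2) {L y : ℝ} (hL : 0 ≤ L) (hy : y ≤ -Y0) :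
    ∫ s in (0:ℝ)..L, st b φ s y ≤ 
      (1 + A / Y0 ^ 2) * (Real.exp (lam / 2 * (φ y - M)) / (lam / 2)) := by
  have hl : 0 < lam / 2 := by linarith [P.hlam]
  have hy0 : y < 0 := by linarith
  have h2 := exp_int (q := φ y - M) hl hL
  rw [sub_zero] at h2
  have hC : 0 < 1 + A / Y0 ^ 2 := by positivity
  refine le_trans ?_ (mul_le_mul_of_nonneg_left h2 hC.le)
  rw [← intervalIntegral.integral_const_mul]
  refine intervalIntegral.integral_mono_on_of_le_Ioo hL ?_ ?_ fun s hs => ?_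
  · exact ii_of_cont hL ((slice_s (P.st_cont P.bc) hy0).mono fun s h => h.1)
  · exact (by fun_prop : Continuous fun s => (1 + A / Y0 ^ 2) * Real.exp (lam / 2 * (φ y - M - s))).intervalIntegrable _ _
  · exact (le_abs_self _).trans (P.gE hA hY hkey hs.1 hy).2

lemma E5 (P : Pkg γ M lam W a b φ φ') {L yb ya : ℝ} (hL : 0 ≤ L) (hy : yb ≤ ya) (hya : ya < 0) :
    φ yb - (∫ s in (0:ℝ)..L, st W φ s yb) = φ ya - (∫ s in (0:ℝ)..L, st W φ s ya) +
      (∫ s in (0:ℝ)..L, st b φ s ya) * (ya - yb) + 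
      (∫ y in yb..ya, ∫ t in y..ya, (√(1 + φ' t ^ 2) - γ)) -
      (∫ y in yb..ya, φ' y * st W φ L y) - ∫ y in yb..ya, ∫ t in y..ya, Zf γ W a b φ φ' L t := by
  have h4 := P.E4 hL hy hya
  have hsub : ∀ y ∈ Icc yb ya, y < 0 := fun y h => lt_of_le_of_lt h.2 hya
  have cφ : ContinuousOn φ' (Icc yb ya) := P.φ'c'.mono hsub
  have cW : ContinuousOn (fun y => st W φ L y) (Icc yb ya) := 
    (slice_y (P.st_cont P.Wc) (mem_Ici.2 hL)).mono hsub
  have cJ := P.Jcont hL hy hya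
  have prim : ∀ f : ℝ → ℝ, ContinuousOn f (Icc yb ya) → 
      ContinuousOn (fun y => ∫ t in y..ya, f t) (Icc yb ya) := by
    intro f hf
    have := intervalIntegral.continuousOn_primitive_interval (μ := MeasureTheory.volume)
      (f := f) (a := ya) (b := yb) (by
        rw [uIcc_comm, uIcc_of_le hy]
        exact hf.integrableOn_compact isCompact_Icc)
    rw [uIcc_comm, uIcc_of_le hy] at this
    refine this.neg.congr fun s _ => ?_
    rw [intervalIntegral.integral_symm]; rfl
  have cS := prim _ (P.Scont.mono hsub)
  have cZ := prim _ ((slice_y P.Zf_cont (mem_Ici.2 hL)).mono hsub)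
  have hphi : ∫ y in yb..ya, φ' y = φ ya - φ yb := by
    refine intervalIntegral.integral_eq_sub_of_hasDerivAt (fun y hy' => ?_) (ii_of_cont hy cφ)
    rw [uIcc_of_le hy] at hy'
    exact P.dφ y (hsub y hy')
  have e1 : ∫ y in yb..ya, (φ' y * (1 - st W φ L y) + ∫ s in (0:ℝ)..L, st b φ s y) =
      ∫ y in yb..ya, ((φ' y - φ' y * st W φ L y) + (((∫ s in (0:ℝ)..L, st b φ s ya) + 
      (∫ t in y..ya, (√(1 + φ' t ^ 2) - γ))) - ∫ t in y..ya, Zf γ W a b φ φ' L t)) := by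
    refine intervalIntegral.integral_congr fun y hy' => ?_
    rw [uIcc_of_le hy] at hy'
    rw [P.E3 hL hy'.2 hya]
    ring
  have i1 := ii_of_cont hy cφ
  have i2 : IntervalIntegrable (fun y => φ' y * st W φ L y) MeasureTheory.volume yb ya :=
    ii_of_cont hy (cφ.mul cW)
  have i3 := ii_of_cont hy cS
  have i4 := ii_of_cont hy cZ
  have i0 : IntervalIntegrable (fun _ : ℝ => ∫ s in (0:ℝ)..L, st b φ s ya) MeasureTheory.volume yb ya :=
    intervalIntegrable_const
  rw [e1, intervalIntegral.integral_add (i1.sub i2) ((i0.add i3).sub i4), 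
    intervalIntegral.integral_sub i1 i2, intervalIntegral.integral_sub (i0.add i3) i4,
    intervalIntegral.integral_add i0 i3, hphi, intervalIntegral.integral_const, smul_eq_mul] at h4
  linarith

lemma Zlow (P : Pkg γ M lam W a b φ φ') {A Y0 : ℝ} (hA : 0 < A) (hY : 0 < Y0)
    (hkey : ∀ X ∈ Om φ, X.2 ≤ -Y0 →
      √(a X ^ 2 + b X ^ 2) ≤ W X + A * (√(W X) - W X) / X.2 ^ 2) :
    ∃ C1 C2 : ℝ, ∀ yb ≤ -Y0, -C2 - C1 * (-yb) ≤ 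
      ∫ y in yb..(-Y0), ∫ t in y..(-Y0), (√(1 + φ' t ^ 2) - γ) := by
  set ya := -Y0 with hyad
  have hya : ya < 0 := by linarith
  have hl : 0 < lam / 2 := by linarith [P.hlam]
  set C := 1 + A / Y0 ^ 2 with hCd
  have hC : 0 < C := by positivity
  set C1 := C * (Real.exp (lam / 2 * (φ ya - M)) / (lam / 2)) with hC1
  have hC1p : 0 < C1 := by positivity
  refine ⟨C1, φ ya - M + 1 / lam, fun yb hy => ?_⟩
  have hyb : yb < 0 := by linarith
  have hsub : ∀ y ∈ Icc yb ya, y < 0 := fun y h => lt_of_le_of_lt h.2 hya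
  obtain ⟨B, hB⟩ := isCompact_Icc.exists_bound_of_continuousOn (P.φ'c'.mono hsub)
  obtain ⟨F, hF⟩ := isCompact_Icc.exists_bound_of_continuousOn (P.φc.mono hsub)
  have hB0 : 0 ≤ B := (norm_nonneg _).trans (hB ya ⟨hy, le_rfl⟩)
  set II := ∫ y in yb..ya, ∫ t in y..ya, (√(1 + φ' t ^ 2) - γ) with hII
  set K := B * (ya - yb) + (C + B * C + γ) * (ya - yb) * (ya - yb) with hK
  have hd : 0 ≤ ya - yb := by linarith
  have hγ := P.hγ
  -- main estimate for each L
  have main : ∀ L, 0 < L → φ yb - M ≤ L → M - 1 / lam ≤ φ ya + C1 * (ya - yb) + II + 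
      K * Real.exp (lam / 2 * (F - M - L)) := by
    intro L hL hLs
    have h5 := P.E5 hL.le hy hya
    rw [← hII] at h5
    have hI := P.Ibound hyb hLs
    have hJ := P.Jbound hA hY hkey hL.le (le_of_eq hyad)
    rw [← hCd, ← hC1] at hJ
    have hI0 : 0 ≤ ∫ s in (0:ℝ)..L, st W φ s ya :=
      intervalIntegral.integral_nonneg hL.le fun s hs => (P.Wpos _ (mem_Cl hs.1 hya)).le
    set E := Real.exp (lam / 2 * (F - M - L)) with hE
    have hE0 : 0 < E := Real.exp_pos _
    have hEy : ∀ y ∈ Icc yb ya, Real.exp (lam / 2 * (φ y - M - L)) ≤ E := by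
      intro y hy'
      have := le_trans (le_abs_self _) (hF y hy')
      rw [hE]; gcongr
    have b1 : ∀ y ∈ Icc yb ya, ‖φ' y * st W φ L y‖ ≤ B * E := by
      intro y hy'
      rw [norm_mul]
      have hw : 0 < st W φ L y := P.Wpos _ (mem_Cl hL.le (hsub y hy'))
      have h1 := hB y hy'
      have h2 : ‖st W φ L y‖ ≤ E := by
        rw [Real.norm_of_nonneg hw.le]
        exact (P.WE hL.le (hsub y hy')).trans (hEy y hy')
      gcongr
    have b2 : ∀ y ∈ Icc yb ya, ‖Zf γ W a b φ φ' L y‖ ≤ (C + B * C + γ) * E := by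
      intro y hy'
      have hw : 0 < st W φ L y := P.Wpos _ (mem_Cl hL.le (hsub y hy'))
      have h1 := hB y hy'
      have h2 : st W φ L y ≤ E := (P.WE hL.le (hsub y hy')).trans (hEy y hy')
      obtain ⟨h3, h4⟩ := P.gE hA hY hkey hL hy'.2
      have h6 := mul_le_mul_of_nonneg_left (hEy y hy') hC.le
      replace h3 := h3.trans h6
      replace h4 := h4.trans h6
      unfold Zf
      calc ‖st a φ L y - φ' y * st b φ L y - γ * st W φ L y‖ ≤ 
            ‖st a φ L y‖ + ‖φ' y * st b φ L y‖ + ‖γ * st W φ L y‖ := 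
              (norm_sub_le _ _).trans (add_le_add (norm_sub_le _ _) le_rfl)
        _ ≤ C * E + B * (C * E) + γ * E := by
            rw [norm_mul, norm_mul, Real.norm_of_nonneg hw.le, Real.norm_of_nonneg (by linarith : 0 ≤ γ)]
            have h4' : ‖st b φ L y‖ ≤ C * E := h4
            have h3' : ‖st a φ L y‖ ≤ C * E := h3
            gcongr
        _ = _ := by ring
    have n1 : ‖∫ y in yb..ya, φ' y * st W φ L y‖ ≤ B * E * (ya - yb) := by
      have := intervalIntegral.norm_integral_le_of_norm_le_const (a := yb) (b := ya) (C := B * E)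
        (f := fun y => φ' y * st W φ L y) fun y hy' => b1 y (by
          rw [uIoc_of_le hy] at hy'; exact Ioc_subset_Icc_self hy')
      rwa [abs_of_nonneg hd] at this
    have n2 : ‖∫ y in yb..ya, ∫ t in y..ya, Zf γ W a b φ φ' L t‖ ≤ 
        (C + B * C + γ) * E * (ya - yb) * (ya - yb) := by
      have := intervalIntegral.norm_integral_le_of_norm_le_const (a := yb) (b := ya) 
        (C := (C + B * C + γ) * E * (ya - yb))
        (f := fun y => ∫ t in y..ya, Zf γ W a b φ φ' L t) fun y hy' => by
          rw [uIoc_of_le hy] at hy'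
          have := intervalIntegral.norm_integral_le_of_norm_le_const (a := y) (b := ya) 
            (C := (C + B * C + γ) * E)
            (f := fun t => Zf γ W a b φ φ' L t) fun t ht => b2 t (by
              rw [uIoc_of_le hy'.2] at ht
              exact ⟨hy'.1.le.trans ht.1.le, ht.2⟩)
          refine this.trans ?_
          rw [abs_of_nonneg (by linarith [hy'.2])]
          have : ya - y ≤ ya - yb := by linarith [hy'.1]
          gcongr
      rwa [abs_of_nonneg hd] at this
    have n1' := (abs_le.1 n1).1
    have n2' := (abs_le.1 n2).1
    have hJ' := mul_le_mul_of_nonneg_right hJ hd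
    have eK : K * E = B * E * (ya - yb) + (C + B * C + γ) * E * (ya - yb) * (ya - yb) := by
      rw [hK]; ring
    rw [eK]
    linarith
  have lim : Tendsto (fun L => φ ya + C1 * (ya - yb) + II + K * Real.exp (lam / 2 * (F - M - L))) atTop
      (𝓝 (φ ya + C1 * (ya - yb) + II + K * 0)) := by
    refine Tendsto.add tendsto_const_nhds (Tendsto.const_mul K ?_)
    refine Real.tendsto_exp_atBot.comp (Tendsto.const_mul_atBot hl ?_)
    exact tendsto_const_nhds.add_atBot tendsto_neg_atTop_atBot
  have fin := ge_of_tendsto lim (by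
    filter_upwards [eventually_gt_atTop 0, eventually_ge_atTop (φ yb - M)] with L h1 h2 using main L h1 h2)
  have : C1 * ya ≤ 0 := by nlinarith
  nlinarith

end Pkg


lemma prim_deriv {f : ℝ → ℝ} {Y0 T : ℝ} (hf : ContinuousOn f (Ioi 0)) (hY : 0 < Y0) (hT : 0 < T) :
    HasDerivAt (fun T => ∫ t in Y0..T, f t) (f T) T := by
  apply intervalIntegral.integral_hasDerivAt_right
  · refine ContinuousOn.intervalIntegrable (hf.mono fun t ht => ?_)
    exact lt_of_lt_of_le (lt_min hY hT) ht.1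
  · exact hf.stronglyMeasurableAtFilter isOpen_Ioi T hT
  · exact hf.continuousAt (Ioi_mem_nhds hT)

namespace Pkg
variable {γ M lam : ℝ} {W a b : ℝ × ℝ → ℝ} {φ φ' : ℝ → ℝ}

lemma assemble (P : Pkg γ M lam W a b φ φ') {α : ℝ} (hα : α ∈ Ioo 0 (π / 2)) (hsin : Real.sin α = 1 / γ) :
    Tendsto φ' atBot (𝓝 (-(Real.cos α / Real.sin α))) := by
  obtain ⟨A, Y0, hA, hY, hkey⟩ := P.key
  obtain ⟨C1, C2, hZl⟩ := P.Zlow hA hY hkey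
  set Θ : ℝ → ℝ := fun T => Real.arctan (- φ' (-T)) with hΘ
  have hdφ' : ∀ y < 0, HasDerivAt φ' (deriv φ' y) y := fun y hy =>
    ((P.φ'c.contDiffAt (Iio_mem_nhds hy)).differentiableAt one_ne_zero).hasDerivAt
  have hΘd : ∀ T > 0, HasDerivAt Θ (deriv Θ T) T := by
    intro T hT
    have h1 : HasDerivAt (fun T : ℝ => φ' (-T)) (deriv φ' (-T) * (-1)) T :=
      HasDerivAt.comp T (hdφ' (-T) (by linarith)) (hasDerivAt_neg T)
    exact h1.neg.arctan.differentiableAt.hasDerivAt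
  have hΘc : ContinuousOn Θ (Ioi 0) := fun T hT => (hΘd T hT).continuousAt.continuousWithinAt
  have hcc : ContinuousOn (fun t => Real.cos (Θ t)) (Ioi 0) := Real.continuous_cos.comp_continuousOn hΘc
  set g : ℝ → ℝ := fun t => γ * Real.cos (Θ t) - 1 + A / t ^ 2 with hg
  have hgc : ContinuousOn g (Ioi 0) := by
    refine ((continuousOn_const.mul hcc).sub continuousOn_const).add 
      (continuousOn_const.div (by fun_prop) fun t ht => pow_ne_zero _ (ne_of_gt ht))
  have hcos : ∀ T, 0 < Real.cos (Θ T) := fun T => Real.cos_arctan_pos _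
  set h : ℝ → ℝ := fun t => (Real.cos (Θ t))⁻¹ - γ with hh
  have hhc : ContinuousOn h (Ioi 0) := (hcc.inv₀ fun t _ => (hcos t).ne').sub continuousOn_const
  set z : ℝ → ℝ := fun T => ∫ t in Y0..T, h t with hz
  have hzd : ∀ T > 0, HasDerivAt z (h T) T := fun T hT => prim_deriv hhc hY hT
  have hzc : ContinuousOn z (Ioi 0) := fun T hT => (hzd T hT).continuousAt.continuousWithinAt
  have main : Tendsto Θ atTop (𝓝 (π / 2 - α)) := by
    refine ode_part (γ := γ) (A := A) (T0 := Y0) (M := M) (C1 := C1) (C2 := C2) (Θ' := deriv Θ)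
      (Φ := fun T => φ (-T)) (z := z) (Z := fun T => ∫ t in Y0..T, z t) P.hγ hY hA.le ?_ ?_ ?_ ?_ ?_ ?_ ?_ ?_
      hα hsin
    · intro T _
      exact abs_lt.2 ⟨by linarith [Real.neg_pi_div_two_lt_arctan (- φ' (-T))], Real.arctan_lt_pi_div_two _⟩
    · exact fun T hT => hΘd T (hY.trans hT)
    · intro T hT
      have hT0 : 0 < T := hY.trans hT
      have hG : HasDerivAt (fun T => Real.sin (Θ T) + ∫ t in Y0..T, g t) 
          (Real.cos (Θ T) * deriv Θ T + g T) T := (hΘd T hT0).sin.add (prim_deriv hgc hY hT0)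
      have hmono : MonotoneOn (fun T => Real.sin (Θ T) + ∫ t in Y0..T, g t) (Ioi Y0) := by
        intro T1 h1 T2 h2 h12
        have h1' : Y0 < T1 := h1
        have h2' : Y0 < T2 := h2
        have hi := P.ode_ineq hA hY hkey (y1 := -T2) (y2 := -T1) (by linarith) (by linarith)
        rw [← intervalIntegral.integral_comp_neg] at hi
        have ii : ∀ s t, 0 < s → 0 < t → IntervalIntegrable g MeasureTheory.volume s t := fun s t hs ht =>
          ContinuousOn.intervalIntegrable (hgc.mono fun r hr => lt_of_lt_of_le (lt_min hs ht) hr.1)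
        have e := intervalIntegral.integral_add_adjacent_intervals (ii Y0 T1 hY (hY.trans h1')) 
          (ii T1 T2 (hY.trans h1') (hY.trans h2'))
        have e2 : ∫ x in T1..T2, (γ * Real.cos (Real.arctan (- φ' (-x))) - 1 + A / (-x) ^ 2) = 
            ∫ t in T1..T2, g t := by
          refine intervalIntegral.integral_congr fun t _ => ?_
          simp only [hg, hΘ, neg_sq]
        rw [e2] at hi
        simp only
        rw [← e]
        simp only [hΘ]
        linarith
      have h1 := hmono.derivWithin_nonneg (x := T)
      rw [hG.hasDerivWithinAt.derivWithin (isOpen_Ioi.uniqueDiffWithinAt hT)] at h1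
      simp only [hg] at h1
      linarith
    · exact fun T hT => hzd T (hY.trans hT)
    · exact fun T hT => prim_deriv hzc hY (hY.trans hT)
    · intro T hT
      have := hZl (-T) (by linarith)
      rw [neg_neg, ← intervalIntegral.integral_comp_neg] at this
      refine this.trans (le_of_eq ?_)
      refine intervalIntegral.integral_congr fun t _ => ?_
      simp only [hz]
      rw [← intervalIntegral.integral_comp_neg]
      refine intervalIntegral.integral_congr fun r _ => ?_
      simp only [hh, hΘ]
      rw [sec_eq, neg_sq]
    · intro T hT
      have h1 : HasDerivAt (fun T : ℝ => φ (-T)) (φ' (-T) * (-1)) T :=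
        HasDerivAt.comp T (P.dφ (-T) (by linarith)) (hasDerivAt_neg T)
      refine h1.congr_deriv ?_
      simp [hΘ, Real.tan_arctan]
    · intro T hT
      exact (P.Mφ (-T) (by linarith)).le
  have hs : 0 < Real.sin α := Real.sin_pos_of_pos_of_lt_pi hα.1 (by linarith [hα.2, Real.pi_pos])
  have hc : Real.cos (π / 2 - α) ≠ 0 := by rw [Real.cos_pi_div_two_sub]; exact hs.ne'
  have h1 : Tendsto (fun T => - Real.tan (Θ T)) atTop (𝓝 (- Real.tan (π / 2 - α))) :=
    ((Real.continuousAt_tan.2 hc).tendsto.comp main).neg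
  have h2 := h1.comp tendsto_neg_atBot_atTop
  have e : Real.tan (π / 2 - α) = Real.cos α / Real.sin α := by
    rw [Real.tan_eq_sin_div_cos, Real.sin_pi_div_two_sub, Real.cos_pi_div_two_sub]
  rw [e] at h2
  refine h2.congr fun y => ?_
  simp [hΘ, Real.tan_arctan]

end Pkg


namespace OneSpeciesTW
variable {d D μ c : ℝ} {u : ℝ → ℝ → ℝ}

lemma openO (hu : OneSpeciesTW d D μ c u) : IsOpen (posSet u ∩ {p : ℝ × ℝ | p.2 < 0}) := by
  obtain ⟨V, hV, e⟩ := hu.relOpen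
  have : posSet u ∩ {p : ℝ × ℝ | p.2 < 0} = V ∩ {p : ℝ × ℝ | p.2 < 0} := by
    rw [e]
    ext p
    constructor
    · rintro ⟨⟨h1, _⟩, h3⟩; exact ⟨h1, h3⟩
    · rintro ⟨h1, h3⟩; exact ⟨⟨h1, le_of_lt (show p.2 < 0 from h3)⟩, h3⟩
  rw [this]
  exact hV.inter (isOpen_lt continuous_snd continuous_const)

lemma fdU (hu : OneSpeciesTW d D μ c u) {p : ℝ × ℝ} (hp : p ∈ posSet u ∩ {p : ℝ × ℝ | p.2 < 0}) :
    HasFDerivAt (fun p : ℝ × ℝ => u p.1 p.2) (fderiv ℝ (fun p : ℝ × ℝ => u p.1 p.2) p) p :=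
  ((hu.smooth.contDiffAt (hu.openO.mem_nhds hp)).differentiableAt two_ne_zero).hasFDerivAt

lemma linex (x y : ℝ) : HasDerivAt (fun t : ℝ => (t, y)) ((1 : ℝ), (0 : ℝ)) x :=
  (hasDerivAt_id x).prodMk (hasDerivAt_const x y)
lemma liney (x y : ℝ) : HasDerivAt (fun t : ℝ => (x, t)) ((0 : ℝ), (1 : ℝ)) y :=
  (hasDerivAt_const y x).prodMk (hasDerivAt_id y)

lemma dx (hu : OneSpeciesTW d D μ c u) {p : ℝ × ℝ} (hp : p ∈ posSet u ∩ {p : ℝ × ℝ | p.2 < 0}) :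
    HasDerivAt (fun t => u t p.2) (fderiv ℝ (fun p : ℝ × ℝ => u p.1 p.2) p (1, 0)) p.1 :=
  HasFDerivAt.comp_hasDerivAt (f := fun t : ℝ => (t, p.2)) p.1 (hu.fdU hp) (linex p.1 p.2)
lemma dy (hu : OneSpeciesTW d D μ c u) {p : ℝ × ℝ} (hp : p ∈ posSet u ∩ {p : ℝ × ℝ | p.2 < 0}) :
    HasDerivAt (fun t => u p.1 t) (fderiv ℝ (fun p : ℝ × ℝ => u p.1 p.2) p (0, 1)) p.2 :=
  HasFDerivAt.comp_hasDerivAt (f := fun t : ℝ => (p.1, t)) p.2 (hu.fdU hp) (liney p.1 p.2)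

lemma pdxC (hu : OneSpeciesTW d D μ c u) :
    ContDiffOn ℝ 1 (fun p : ℝ × ℝ => pdx u p.1 p.2) (posSet u ∩ {p : ℝ × ℝ | p.2 < 0}) := by
  have h : ContDiffOn ℝ 1 (fderiv ℝ (fun p : ℝ × ℝ => u p.1 p.2)) (posSet u ∩ {p : ℝ × ℝ | p.2 < 0}) :=
    hu.smooth.fderiv_of_isOpen hu.openO (by norm_num)
  exact (h.clm_apply contDiffOn_const).congr fun p hp => (hu.dx hp).deriv
lemma pdyC (hu : OneSpeciesTW d D μ c u) :
    ContDiffOn ℝ 1 (fun p : ℝ × ℝ => pdy u p.1 p.2) (posSet u ∩ {p : ℝ × ℝ | p.2 < 0}) := by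
  have h : ContDiffOn ℝ 1 (fderiv ℝ (fun p : ℝ × ℝ => u p.1 p.2)) (posSet u ∩ {p : ℝ × ℝ | p.2 < 0}) :=
    hu.smooth.fderiv_of_isOpen hu.openO (by norm_num)
  exact (h.clm_apply contDiffOn_const).congr fun p hp => (hu.dy hp).deriv

lemma dxx (hu : OneSpeciesTW d D μ c u) {p : ℝ × ℝ} (hp : p ∈ posSet u ∩ {p : ℝ × ℝ | p.2 < 0}) :
    HasDerivAt (fun t => pdx u t p.2) (fderiv ℝ (fun p : ℝ × ℝ => pdx u p.1 p.2) p (1, 0)) p.1 :=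
  HasFDerivAt.comp_hasDerivAt (f := fun t : ℝ => (t, p.2)) p.1
    ((hu.pdxC.contDiffAt (hu.openO.mem_nhds hp)).differentiableAt one_ne_zero).hasFDerivAt
    (linex p.1 p.2)
lemma dyy (hu : OneSpeciesTW d D μ c u) {p : ℝ × ℝ} (hp : p ∈ posSet u ∩ {p : ℝ × ℝ | p.2 < 0}) :
    HasDerivAt (fun t => pdy u p.1 t) (fderiv ℝ (fun p : ℝ × ℝ => pdy u p.1 p.2) p (0, 1)) p.2 :=
  HasFDerivAt.comp_hasDerivAt (f := fun t : ℝ => (p.1, t)) p.2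
    ((hu.pdyC.contDiffAt (hu.openO.mem_nhds hp)).differentiableAt one_ne_zero).hasFDerivAt
    (liney p.1 p.2)

lemma H2ux (hu : OneSpeciesTW d D μ c u) {p : ℝ × ℝ} (hp : p ∈ posSet u ∩ {p : ℝ × ℝ | p.2 < 0}) :
    H2 (fun t => u t p.2) p.1 (pdx u p.1 p.2) (pdxx u p.1 p.2) := by
  refine ⟨fun t => pdx u t p.2, ?_, rfl, (hu.dxx hp).differentiableAt.hasDerivAt⟩
  filter_upwards [(linex p.1 p.2).continuousAt.eventually (hu.openO.mem_nhds hp)] with t ht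
  exact (hu.dx ht).differentiableAt.hasDerivAt
lemma H2uy (hu : OneSpeciesTW d D μ c u) {p : ℝ × ℝ} (hp : p ∈ posSet u ∩ {p : ℝ × ℝ | p.2 < 0}) :
    H2 (fun t => u p.1 t) p.2 (pdy u p.1 p.2) (pdyy u p.1 p.2) := by
  refine ⟨fun t => pdy u p.1 t, ?_, rfl, (hu.dyy hp).differentiableAt.hasDerivAt⟩
  filter_upwards [(liney p.1 p.2).continuousAt.eventually (hu.openO.mem_nhds hp)] with t ht
  exact (hu.dy ht).differentiableAt.hasDerivAt

lemma H2_exp (l M k t : ℝ) : H2 (fun s => Real.exp (l * (s - M)) * k) t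
    (l * (Real.exp (l * (t - M)) * k)) (l ^ 2 * (Real.exp (l * (t - M)) * k)) := by
  have h : ∀ s, HasDerivAt (fun s => Real.exp (l * (s - M)) * k) (l * (Real.exp (l * (s - M)) * k)) s := by
    intro s
    have := ((((hasDerivAt_id s).sub_const M).const_mul l).exp.mul_const k)
    refine this.congr_deriv ?_
    simp only [id]; ring
  exact ⟨_, Eventually.of_forall h, rfl, ((h t).const_mul l).congr_deriv (by ring)⟩

lemma H2_q (E η t : ℝ) : H2 (fun s => E * (1 + η * s ^ 2)) t (E * (2 * η * t)) (E * (2 * η)) := by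
  have h : ∀ s, HasDerivAt (fun s => E * (1 + η * s ^ 2)) (E * (2 * η * s)) s := by
    intro s
    have := ((((hasDerivAt_id s).pow 2).const_mul η).const_add 1).const_mul E
    refine this.congr_deriv ?_
    simp only [id]; push_cast; ring
  refine ⟨_, Eventually.of_forall h, rfl, ?_⟩
  exact (((hasDerivAt_id t).const_mul (2 * η)).const_mul E).congr_deriv (by simp)

lemma left_max {g : ℝ → ℝ} {g' : ℝ} (hg : HasDerivAt g g' 0) (hm : ∀ t < 0, g t ≤ g 0) : 0 ≤ g' := by
  have h := (hasDerivWithinAt_iff_tendsto_slope' (s := Iio 0) (by simp)).1 hg.hasDerivWithinAt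
  refine ge_of_tendsto h ?_
  filter_upwards [self_mem_nhdsWithin] with t ht
  rw [slope_def_field]
  have : t < 0 := ht
  exact div_nonneg_of_nonpos (by linarith [hm t ht]) (by linarith)

lemma barrier (hu : OneSpeciesTW d D μ c u) (hd : 0 < d) (hD : 0 < D) (hμ : 0 < μ) {M l η : ℝ}
    (hM : ∀ x ≤ M, ∀ y ≤ (0:ℝ), 1 / 2 < u x y) (hl : 0 < l) (hη : 0 < η)
    (h1 : l ^ 2 - c / d * l + 2 * η < 0) (h2 : D * l ^ 2 - c * l < 0) :
    ∀ x ≤ M, ∀ y ≤ (0:ℝ), 1 - u x y ≤ Real.exp (l * (x - M)) * (1 + η * y ^ 2) := by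
  by_contra! hcon
  obtain ⟨x0, hx0, y0, hy0, hlt⟩ := hcon
  set f : ℝ × ℝ → ℝ := fun p => 1 - u p.1 p.2 - Real.exp (l * (p.1 - M)) * (1 + η * p.2 ^ 2) with hf
  set δ := f (x0, y0) with hδ
  have hδ0 : 0 < δ := by simp only [hδ, hf]; linarith
  obtain ⟨M', hM'⟩ := hu.lim_left δ hδ0
  have hbp : ∀ p : ℝ × ℝ, 0 < Real.exp (l * (p.1 - M)) * (1 + η * p.2 ^ 2) := fun p => by positivity
  have hfar : ∀ p : ℝ × ℝ, p.1 ≤ M' → p.2 ≤ 0 → f p < δ := by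
    intro p hp hp2
    have h3 := (abs_lt.1 (hM' p.1 hp p.2 hp2)).1
    have := hbp p
    simp only [hf]; linarith
  set R := Real.exp (-(l * (M' - M))) / η + 1 with hR
  have hR1 : 1 ≤ R := by
    have : 0 < Real.exp (-(l * (M' - M))) / η := by positivity
    linarith
  have hfar2 : ∀ p : ℝ × ℝ, M' ≤ p.1 → p.2 ≤ -R → f p < δ := by
    intro p hp hp2
    have h3 := (hu.mem01 p.1 p.2 (by linarith)).1
    have h4 : Real.exp (l * (M' - M)) ≤ Real.exp (l * (p.1 - M)) := by gcongr
    have h5 : R ≤ p.2 ^ 2 := by nlinarith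
    have h6 : Real.exp (-(l * (M' - M))) ≤ η * R := by
      rw [hR, mul_add, mul_div_cancel₀ _ hη.ne']; linarith
    have h7 : 1 ≤ Real.exp (l * (p.1 - M)) * (1 + η * p.2 ^ 2) := by
      calc (1:ℝ) = Real.exp (l * (M' - M)) * Real.exp (-(l * (M' - M))) := by
            rw [← Real.exp_add]; simp
        _ ≤ Real.exp (l * (p.1 - M)) * (1 + η * p.2 ^ 2) := by
            have : η * R ≤ η * p.2 ^ 2 := by gcongr
            gcongr
            linarith
    simp only [hf]; linarith
  have hfc : ContinuousOn f lowerH :=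
    (continuousOn_const.sub hu.cont).sub (by fun_prop)
  set K : Set (ℝ × ℝ) := Icc M' M ×ˢ Icc (-R) 0 with hK
  have hp0 : (x0, y0) ∈ K := by
    refine ⟨⟨?_, hx0⟩, ⟨?_, hy0⟩⟩
    · by_contra! h; exact lt_irrefl _ (hfar (x0, y0) h.le hy0)
    · by_contra! h
      rcases le_total M' x0 with h' | h'
      · exact lt_irrefl _ (hfar2 (x0, y0) h' h.le)
      · exact lt_irrefl _ (hfar (x0, y0) h' hy0)
  obtain ⟨p, hpK, hpm⟩ := (isCompact_Icc.prod isCompact_Icc).exists_isMaxOn ⟨_, hp0⟩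
    (hfc.mono fun q hq => hq.2.2)
  have hpδ : δ ≤ f p := hpm hp0
  have hall : ∀ q : ℝ × ℝ, q.1 ≤ M → q.2 ≤ 0 → f q ≤ f p := by
    intro q hq1 hq2
    rcases le_total q.1 M' with h | h
    · exact (hfar q h hq2).le.trans hpδ
    · rcases le_total q.2 (-R) with h' | h'
      · exact (hfar2 q h h').le.trans hpδ
      · exact hpm ⟨⟨h, hq1⟩, ⟨h', hq2⟩⟩
  have hp2 : p.2 ≤ 0 := hpK.2.2
  have hp1 : p.1 < M := by
    refine lt_of_le_of_ne hpK.1.2 fun h => ?_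
    have h3 := (hu.mem01 p.1 p.2 hp2).1
    have h4 : 0 ≤ η * p.2 ^ 2 := by positivity
    have : f p = 1 - u p.1 p.2 - (1 + η * p.2 ^ 2) := by
      simp only [hf]; rw [h]; simp
    linarith
  have hup : 0 < u p.1 p.2 := by linarith [hM p.1 hp1.le p.2 hp2]
  rcases hp2.lt_or_eq with hneg | hzero
  · have hpO : p ∈ posSet u ∩ {p : ℝ × ℝ | p.2 < 0} := ⟨⟨hp2, hup⟩, hneg⟩
    have hloc : IsLocalMax f p := by
      have h3 : ∀ᶠ q : ℝ × ℝ in 𝓝 p, q.1 < M := continuousAt_fst.eventually (gt_mem_nhds hp1)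
      have h4 : ∀ᶠ q : ℝ × ℝ in 𝓝 p, q.2 < 0 := continuousAt_snd.eventually (gt_mem_nhds hneg)
      filter_upwards [h3, h4] with q a b using hall q a.le b.le
    have hx : H2 (fun t => f (t, p.2)) p.1 _ _ := ((H2_const p.1 1).sub (hu.H2ux hpO)).sub 
      (H2_exp l M (1 + η * p.2 ^ 2) p.1)
    have hy : H2 (fun t => f (p.1, t)) p.2 _ _ := ((H2_const p.2 1).sub (hu.H2uy hpO)).sub 
      (H2_q (Real.exp (l * (p.1 - M))) η p.2)
    have hME : MEq (c / d) f p _ := ⟨_, _, _, _, hx, hy, rfl⟩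
    have h5 := hME.nonpos hloc
    have h6 := hu.pde p hpO
    have h7 : pdxx u p.1 p.2 + pdyy u p.1 p.2 = c / d * pdx u p.1 p.2 := by
      field_simp; linarith
    have hE : 0 < Real.exp (l * (p.1 - M)) := Real.exp_pos _
    set E := Real.exp (l * (p.1 - M))
    have h8 : 0 ≤ η * p.2 ^ 2 := by positivity
    have h9 : E * ((l ^ 2 - c / d * l) * (1 + η * p.2 ^ 2) + 2 * η) < 0 := by
      refine mul_neg_of_pos_of_neg hE ?_
      have : l ^ 2 - c / d * l < 0 := by linarith
      nlinarith
    nlinarith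
  · have hx : H2 (fun t => u t 0) p.1 (pdx u p.1 0) (pdxx u p.1 0) := by
      refine ⟨fun t => pdx u t 0, ?_, rfl, (hu.road_diffxx p.1 (hzero ▸ hup)).hasDerivAt⟩
      filter_upwards [gt_mem_nhds hp1] with t ht
      exact (hu.road_diffx t (by linarith [hM t (le_of_lt ht) 0 le_rfl])).hasDerivAt
    have hX : H2 (fun t => f (t, 0)) p.1 _ _ := ((H2_const p.1 1).sub hx).sub 
      (H2_exp l M (1 + η * 0 ^ 2) p.1)
    have hloc : IsLocalMax (fun t => f (t, 0)) p.1 := by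
      filter_upwards [gt_mem_nhds hp1] with t ht
      have := hall (t, 0) (le_of_lt ht) le_rfl
      have e : p = (p.1, 0) := by rw [← hzero]
      rw [e] at this
      exact this
    obtain ⟨k1, k2⟩ := hX.nonpos hloc
    have hyd : HasDerivAt (fun t => u p.1 t) (pdy u p.1 0) 0 := 
      (hu.road_diffy p.1 (hzero ▸ hup)).hasDerivAt
    have hY : HasDerivAt (fun t => f (p.1, t)) _ 0 := (hyd.const_sub 1).sub 
      (H2_q (Real.exp (l * (p.1 - M))) η 0).hasDerivAt
    have k3 := left_max hY fun t ht => by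
      have := hall (p.1, t) hp1.le ht.le
      have e : p = (p.1, 0) := by rw [← hzero]
      rw [e] at this
      exact this
    have k4 := hu.road p.1 (hzero ▸ hup)
    have hE : 0 < Real.exp (l * (p.1 - M)) := Real.exp_pos _
    set E := Real.exp (l * (p.1 - M))
    have k5 : 1 / μ * pdy u p.1 0 ≤ 0 := by
      refine mul_nonpos_of_nonneg_of_nonpos (by positivity) ?_
      linarith
    have k6 : pdx u p.1 0 = - (l * E) := by linarith
    have k7 : - (l ^ 2 * E) ≤ pdxx u p.1 0 := by linarith
    have k8 : (D * l ^ 2 - c * l) * E < 0 := mul_neg_of_neg_of_pos h2 hE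
    have k9 := mul_le_mul_of_nonneg_left k7 hD.le
    rw [k6] at k4
    nlinarith

end OneSpeciesTW


lemma conn_frontier {X : Type*} [TopologicalSpace X] {s t : Set X} (ht : IsPreconnected t)
    (h1 : (t ∩ s).Nonempty) (h2 : (t ∩ sᶜ).Nonempty) : (t ∩ frontier s).Nonempty := by
  by_contra hne
  rw [not_nonempty_iff_eq_empty] at hne
  have hnf : ∀ x ∈ t, x ∉ frontier s := fun x hx hf => by
    have : x ∈ t ∩ frontier s := ⟨hx, hf⟩
    rw [hne] at this
    exact this
  obtain ⟨x, hx, hxs⟩ := h1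
  obtain ⟨y, hy, hys⟩ := h2
  have hi : ∀ z ∈ t, z ∈ closure s → z ∈ interior s := fun z hz hc => by
    by_contra h
    exact hnf z hz ⟨hc, h⟩
  obtain ⟨z, _, hz1, hz2⟩ := ht (interior s) (closure s)ᶜ isOpen_interior isClosed_closure.isOpen_compl
    (fun z hz => by
      by_cases h : z ∈ closure s
      · exact Or.inl (hi z hz h)
      · exact Or.inr h)
    ⟨x, hx, hi x hx (subset_closure hxs)⟩
    ⟨y, hy, fun h => hys (interior_subset (hi y hy h))⟩
  exact hz2 (subset_closure (interior_subset hz1))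

namespace OneSpeciesTW
variable {d D μ c : ℝ} {u : ℝ → ℝ → ℝ}

lemma decay (hu : OneSpeciesTW d D μ c u) (hd : 0 < d) (hD : 0 < D) (hμ : 0 < μ) :
    ∃ M l : ℝ, 0 < l ∧ (∀ x ≤ M, ∀ y ≤ (0:ℝ), 1 / 2 < u x y) ∧
      ∀ x ≤ M, ∀ y ≤ (0:ℝ), 1 - u x y ≤ Real.exp (l * (x - M)) := by
  obtain ⟨M, hM⟩ := hu.lim_left (1 / 2) (by norm_num)
  have hc := hu.c_pos
  set l := min (c / d) (c / D) / 2 with hl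
  have h0 : 0 < l := by positivity
  have h1 : l ≤ c / d / 2 := by rw [hl]; gcongr; exact min_le_left _ _
  have h2 : l ≤ c / D / 2 := by rw [hl]; gcongr; exact min_le_right _ _
  have hcd : 0 < c / d := by positivity
  have hM' : ∀ x ≤ M, ∀ y ≤ (0:ℝ), 1 / 2 < u x y := fun x hx y hy => by
    have := (abs_lt.1 (hM x hx y hy)).1
    linarith
  refine ⟨M, l, h0, hM', fun x hx y hy => ?_⟩
  have h3 : l ^ 2 - c / d * l < 0 := by nlinarith
  have h4 : D * l ^ 2 - c * l < 0 := by
    have : D * l ≤ c / 2 := by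
      calc D * l ≤ D * (c / D / 2) := by gcongr
        _ = c / 2 := by field_simp
    nlinarith
  have lim : Tendsto (fun η : ℝ => Real.exp (l * (x - M)) * (1 + η * y ^ 2)) (𝓝[>] 0) 
      (𝓝 (Real.exp (l * (x - M)) * (1 + 0 * y ^ 2))) := by
    have : Continuous fun η : ℝ => Real.exp (l * (x - M)) * (1 + η * y ^ 2) := by fun_prop
    exact (this.tendsto 0).mono_left nhdsWithin_le_nhds
  have h5 := ge_of_tendsto lim (b := 1 - u x y) (by
    have h6 : ∀ᶠ η : ℝ in 𝓝[>] 0, η < -(l ^ 2 - c / d * l) / 2 :=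
      nhdsWithin_le_nhds (gt_mem_nhds (by linarith))
    filter_upwards [self_mem_nhdsWithin, h6] with η hη hη2
    exact hu.barrier hd hD hμ hM' h0 hη (by linarith) h4 x hx y hy)
  simpa using h5

lemma notpos_of_bdry (hu : OneSpeciesTW d D μ c u) {p : ℝ × ℝ} (hp : p ∈ freeBdry u) : u p.1 p.2 = 0 := by
  obtain ⟨h1, h2⟩ := hp
  have h2' : p.2 < 0 := h2
  by_contra hne
  have h3 := (hu.mem01 p.1 p.2 h2'.le).1
  have hp : p ∈ posSet u ∩ {p : ℝ × ℝ | p.2 < 0} := ⟨⟨h2'.le, lt_of_le_of_ne h3 (Ne.symm hne)⟩, h2⟩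
  have : p ∈ interior (posSet u) := 
    interior_mono inter_subset_left (hu.openO.interior_eq.symm ▸ hp)
  exact h1.2 this

lemma toPkg (hu : OneSpeciesTW d D μ c u) (hd : 0 < d) (hD : 0 < D) (hμ : 0 < μ)
    (hmono : ∀ p ∈ posSet u, pdx u p.1 p.2 < 0)
    (φ : ℝ → ℝ) (hφa : AnalyticOnNhd ℝ φ (Iio 0))
    (hΓ : freeBdry u = {p : ℝ × ℝ | ∃ y < (0:ℝ), p = (φ y, y)}) (hc : d < c) :
    ∃ M lam W a b, Pkg (c / d) M lam W a b φ (deriv φ) := by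
  obtain ⟨M, l, hl, hM, hdec⟩ := hu.decay hd hD hμ
  obtain ⟨G₁, G₂, hG1, hG2, hG, hGb⟩ := hu.grad_ext
  have hbd : ∀ y < 0, (φ y, y) ∈ freeBdry u := fun y hy => by rw [hΓ]; exact ⟨y, hy, rfl⟩
  have hu0 : ∀ y < 0, u (φ y) y = 0 := fun y hy => hu.notpos_of_bdry (hbd y hy)
  have hMφ : ∀ y < 0, M < φ y := by
    intro y hy
    by_contra! h
    have := hM (φ y) h y hy.le
    rw [hu0 y hy] at this
    linarith
  have hOm : Om φ ⊆ posSet u ∩ {p : ℝ × ℝ | p.2 < 0} := by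
    rintro ⟨x, y⟩ ⟨hy, hx⟩
    simp only at hy hx
    refine ⟨⟨hy.le, ?_⟩, hy⟩
    by_contra hnp
    simp only at hnp
    have hMx : M ≤ x := by
      by_contra! h
      linarith [hM x h.le y hy.le]
    have hpc : IsPreconnected (Icc M x ×ˢ ({y} : Set ℝ)) := isPreconnected_Icc.prod isPreconnected_singleton
    obtain ⟨q, hq, hqf⟩ := conn_frontier hpc (s := posSet u)
      ⟨(M, y), ⟨⟨le_rfl, hMx⟩, rfl⟩, hy.le, by have := hM M le_rfl y hy.le; simp only; linarith⟩
      ⟨(x, y), ⟨⟨hMx, le_rfl⟩, rfl⟩, fun h => hnp h.2⟩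
    have hq2 : q.2 = y := hq.2
    have hqb : q ∈ freeBdry u := ⟨hqf, by simp only [mem_setOf_eq, hq2]; exact hy⟩
    rw [hΓ] at hqb
    obtain ⟨y', _, e⟩ := hqb
    have e2 : y' = y := by rw [← hq2, e]
    have e1 : q.1 = φ y := by rw [e, ← e2]
    have := hq.1.2
    linarith
  have hCl : Cl φ ⊆ posSet u ∪ freeBdry u := by
    rintro ⟨x, y⟩ ⟨hy, hx⟩
    simp only at hy hx
    rcases hx.lt_or_eq with h | h
    · exact Or.inl (hOm ⟨hy, h⟩).1
    · right; rw [h]; exact hbd y hy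
  have hOo : IsOpen (Om φ) := by
    rw [isOpen_iff_mem_nhds]
    rintro p ⟨h1, h2⟩
    have hc : ContinuousAt (fun q : ℝ × ℝ => φ q.2 - q.1) p :=
      ((hφa p.2 h1).continuousAt.comp continuousAt_snd).sub continuousAt_fst
    filter_upwards [hc.eventually (lt_mem_nhds (sub_pos.2 h2)),
      continuousAt_snd.eventually (gt_mem_nhds h1)] with q hq hq'
    exact ⟨hq', sub_pos.1 hq⟩
  have hlt : ∀ p ∈ Om φ, u p.1 p.2 < 1 := by
    rintro ⟨x, y⟩ ⟨hy, hx⟩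
    simp only at hy hx
    have hm : ∀ t ≤ x, (t, y) ∈ posSet u ∩ {p : ℝ × ℝ | p.2 < 0} := fun t ht =>
      hOm ⟨hy, lt_of_le_of_lt ht hx⟩
    have ha : StrictAntiOn (fun t => u t y) (Icc (x - 1) x) := by
      refine strictAntiOn_of_deriv_neg (convex_Icc _ _) ?_ fun t ht => ?_
      · exact fun t ht => (hu.dx (hm t ht.2)).continuousAt.continuousWithinAt
      · rw [interior_Icc] at ht
        exact hmono _ (hm t ht.2.le).1
    have h1 := ha (a := x - 1) (b := x) ⟨le_rfl, by linarith⟩ ⟨by linarith, le_rfl⟩ (by linarith)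
    exact lt_of_lt_of_le h1 (hu.mem01 (x - 1) y hy.le).2
  have ea : ∀ p ∈ Om φ, -G₁ p = -pdx u p.1 p.2 := fun p hp => by rw [(hG p (hOm hp)).1]
  have eb : ∀ p ∈ Om φ, -G₂ p = -pdy u p.1 p.2 := fun p hp => by rw [(hG p (hOm hp)).2]
  refine ⟨M, l, fun p => 1 - u p.1 p.2, fun p => -G₁ p, fun p => -G₂ p, ?_⟩
  constructor
  · rwa [one_lt_div hd]
  · exact hl
  · exact continuousOn_const.sub (hu.cont.mono fun p hp => le_of_lt (show p.2 < 0 from hp.1))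
  · exact (hG1.mono hCl).neg
  · exact (hG2.mono hCl).neg
  · intro p hp
    have h := (hu.fdU (hOm hp)).const_sub 1
    refine h.congr_fderiv ?_
    rw [ea p hp, eb p hp]
    have e1 : fderiv ℝ (fun p : ℝ × ℝ => u p.1 p.2) p (1, 0) = pdx u p.1 p.2 := (hu.dx (hOm hp)).deriv.symm
    have e2 : fderiv ℝ (fun p : ℝ × ℝ => u p.1 p.2) p (0, 1) = pdy u p.1 p.2 := (hu.dy (hOm hp)).deriv.symm
    ext
    · simp [e1]
    · simp [e2]
  · exact (hu.pdxC.mono hOm).neg.congr ea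
  · exact (hu.pdyC.mono hOm).neg.congr eb
  · intro p hp
    have h1 : (fun p => -G₁ p) =ᶠ[𝓝 p] fun p => -pdx u p.1 p.2 :=
      eventually_of_mem (hOo.mem_nhds hp) ea
    have h2 : (fun p => -G₂ p) =ᶠ[𝓝 p] fun p => -pdy u p.1 p.2 :=
      eventually_of_mem (hOo.mem_nhds hp) eb
    rw [h1.fderiv_eq, h2.fderiv_eq, fderiv_fun_neg, fderiv_fun_neg, ea p hp]
    have e1 : fderiv ℝ (fun p : ℝ × ℝ => pdx u p.1 p.2) p (1, 0) = pdxx u p.1 p.2 := 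
      (hu.dxx (hOm hp)).deriv.symm
    have e2 : fderiv ℝ (fun p : ℝ × ℝ => pdy u p.1 p.2) p (0, 1) = pdyy u p.1 p.2 := 
      (hu.dyy (hOm hp)).deriv.symm
    have h6 := hu.pde p (hOm hp)
    have h7 : pdxx u p.1 p.2 + pdyy u p.1 p.2 = c / d * pdx u p.1 p.2 := by
      field_simp; linarith
    simp only [ContinuousLinearMap.neg_apply, e1, e2]
    linarith
  · intro p hp
    rw [ea p hp]
    linarith [hmono p (hOm hp).1]
  · rintro ⟨x, y⟩ ⟨hy, hx⟩
    simp only at hy hx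
    rcases hx.lt_or_eq with h | h
    · have := hlt (x, y) ⟨hy, h⟩
      simp only at this ⊢
      linarith
    · simp only [h, hu0 y hy]; norm_num
  · intro p hp
    have := (hu.mem01 p.1 p.2 (le_of_lt hp.1)).1
    linarith
  · intro y hy
    simp [hu0 y hy]
  · intro y hy
    have := hGb _ (hbd y hy)
    simpa using this
  · intro y hy
    exact (hφa y hy).differentiableAt.hasDerivAt
  · exact hφa.deriv.contDiffOn (uniqueDiffOn_Iio 0)
  · exact hMφ
  · intro x hx y hy
    exact hdec x hx y hy.le

end OneSpeciesTW



/-- Theorem 1.2: asymptotic direction of the free boundary.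
For a travelling wave `(c,u)` of the one-species problem, with `u` globally Lipschitz,
`∂ₓu < 0` on `Ω`, free boundary the locally Lipschitz analytic graph
`Γ = {(φ(y),y) : y < 0}` with `(0,0) ∈ closure Γ`: if `c > c₀ = d` and
`α ∈ (0,π/2)` is defined by `sin α = c₀/c`, then `φ'(y) → -cotan α` as `y → -∞`. -/
theorem free_boundary_asymptotic_direction
    (d D μ c : ℝ) (hd : 0 < d) (hD : 0 < D) (hμ : 0 < μ)
    (u : ℝ → ℝ → ℝ) (hu : OneSpeciesTW d D μ c u)
    (hLip : ∃ K : NNReal, LipschitzOnWith K (fun p : ℝ × ℝ => u p.1 p.2) lowerH)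
    (hmono : ∀ p ∈ posSet u, pdx u p.1 p.2 < 0)
    (φ : ℝ → ℝ)
    (hφa : AnalyticOnNhd ℝ φ (Iio 0))
    (hφl : ∀ y < (0:ℝ), ∃ ε > 0, ∃ K : NNReal, LipschitzOnWith K φ (Metric.ball y ε))
    (hΓ : freeBdry u = {p : ℝ × ℝ | ∃ y < (0:ℝ), p = (φ y, y)})
    (h0 : ((0:ℝ), (0:ℝ)) ∈ closure (freeBdry u))
    (hc : d < c)
    (α : ℝ) (hα : α ∈ Ioo 0 (π/2)) (hsin : Real.sin α = d / c) :
    Tendsto (deriv φ) atBot (𝓝 (-(Real.cos α / Real.sin α))) := by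
  have hcp := hu.c_pos
  obtain ⟨M, lam, W, a, b, P⟩ := hu.toPkg hd hD hμ hmono φ hφa hΓ hc
  refine P.assemble hα ?_
  rw [hsin, one_div_div]
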